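/- The duality operation is involutive: for every n ≥ 0 and every f ∈ C_n, 𝒟_n(𝒟_n(f)) = f. -/

import Mathlib

open Matrix BigOperators

namespace HCPaper

open scoped Classical

/-- `gl F n` : the additive group of `n × n` matrices over `F`. -/
abbrev gl (F : Type) (n : ℕ) := Matrix (Fin n) (Fin n) F

variable {F : Type} [Field F] [Fintype F] [DecidableEq F]

/-- Conjugation (adjoint) action of `GL_n(F)` on `gl_n(F)`. -/
def conjM {n : ℕ} (g : Matrix.GeneralLinearGroup (Fin n) F) (x : gl F n) : gl F n :=
  (g : Matrix (Fin n) (Fin n) F) * x * ((g⁻¹ : Matrix.GeneralLinearGroup (Fin n) F) : Matrix (Fin n) (Fin n) F)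

/-- A function `f : gl_n(F) → ℂ` is invariant if it is constant on `GL_n(F)`-conjugacy orbits. -/
def Invariant (n : ℕ) (f : gl F n → ℂ) : Prop :=
  ∀ (g : Matrix.GeneralLinearGroup (Fin n) F) (x : gl F n), f (conjM g x) = f x

/-- Invariance for functions on `gl_k(F) × gl_l(F)` under `GL_k(F) × GL_l(F)`. -/
def Invariant₂ (k l : ℕ) (h : gl F k × gl F l → ℂ) : Prop :=
  ∀ (g₁ : Matrix.GeneralLinearGroup (Fin k) F) (g₂ : Matrix.GeneralLinearGroup (Fin l) F)
    (x : gl F k) (y : gl F l), h (conjM g₁ x, conjM g₂ y) = h (x, y)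

/-- Transport of matrices along an equality of sizes. -/
def castM {m n : ℕ} (h : m = n) (x : gl F m) : gl F n :=
  Matrix.reindex (finCongr h) (finCongr h) x

/-- Transport of functions along an equality of sizes. -/
def castFun {m n : ℕ} (h : m = n) (f : gl F m → ℂ) : gl F n → ℂ :=
  fun x => f (castM h.symm x)

/-- The block upper-triangular matrix `[x u; 0 y]`, viewed in `gl_{k+l}(F)`. -/
def but (k l : ℕ) (x : gl F k) (u : Matrix (Fin k) (Fin l) F) (y : gl F l) : gl F (k + l) :=
  Matrix.reindex finSumFinEquiv finSumFinEquiv (Matrix.fromBlocks x u 0 y)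

/-- The block lower-triangular matrix `[x 0; v y]`, viewed in `gl_{k+l}(F)`. -/
def blt (k l : ℕ) (x : gl F k) (v : Matrix (Fin l) (Fin k) F) (y : gl F l) : gl F (k + l) :=
  Matrix.reindex finSumFinEquiv finSumFinEquiv (Matrix.fromBlocks x 0 v y)

/-- View a matrix in `gl_{k+l}(F)` as a `2 × 2`-block matrix. -/
def blk (k l : ℕ) (m : gl F (k + l)) : Matrix (Fin k ⊕ Fin l) (Fin k ⊕ Fin l) F :=
  Matrix.reindex finSumFinEquiv.symm finSumFinEquiv.symm m

/-- Membership in `P_{k,l}` : being block upper triangular with blocks of sizes `k, l`. -/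
def IsBUT (k l : ℕ) (m : gl F (k + l)) : Prop := Matrix.toBlocks₂₁ (blk k l m) = 0

/-- The projection `π : P_{k,l} → gl_k(F) × gl_l(F)` deleting the off-diagonal block. -/
def proj (k l : ℕ) (m : gl F (k + l)) : gl F k × gl F l :=
  (Matrix.toBlocks₁₁ (blk k l m), Matrix.toBlocks₂₂ (blk k l m))

/-- The order of the group `P^×_{k,l}` of invertible block upper-triangular matrices. -/
noncomputable def Pcard (F : Type) [Field F] [Fintype F] [DecidableEq F] (k l : ℕ) : ℕ :=
  Nat.card {g : Matrix.GeneralLinearGroup (Fin (k + l)) F //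
    IsBUT k l (g : Matrix (Fin (k + l)) (Fin (k + l)) F)}

/-- Harish-Chandra restriction `*R^{k+l}_{k,l}`; by convention it is the identity
(under the canonical identifications) when `k = 0` or `l = 0`. -/
noncomputable def HCres (k l : ℕ) (f : gl F (k + l) → ℂ) : gl F k × gl F l → ℂ :=
  if hk : k = 0 then fun p => f (castM (by omega) p.2)
  else if hl : l = 0 then fun p => f (castM (by omega) p.1)
  else fun p =>
    ((Fintype.card F : ℂ) ^ (k * l))⁻¹ * ∑ u : Matrix (Fin k) (Fin l) F, f (but k l p.1 u p.2)

/-- Harish-Chandra induction `R^{k+l}_{k,l}`; by convention it is the identity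
(under the canonical identifications) when `k = 0` or `l = 0`. -/
noncomputable def HCind (k l : ℕ) (h : gl F k × gl F l → ℂ) : gl F (k + l) → ℂ :=
  if hk : k = 0 then fun z => h (0, castM (by omega) z)
  else if hl : l = 0 then fun z => h (castM (by omega) z, 0)
  else fun z =>
    ((Pcard F k l : ℂ))⁻¹ *
      ∑ g : Matrix.GeneralLinearGroup (Fin (k + l)) F,
        if IsBUT k l (conjM g z) then h (proj k l (conjM g z)) else 0

/-- The hermitian inner product on `C_n`. -/
noncomputable def inn (n : ℕ) (f g : gl F n → ℂ) : ℂ :=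
  ((Fintype.card (Matrix.GeneralLinearGroup (Fin n) F) : ℂ))⁻¹ *
    ∑ x : gl F n, f x * (starRingEnd ℂ) (g x)

/-- The hermitian inner product on invariant functions on `gl_k(F) × gl_l(F)`. -/
noncomputable def inn₂ (k l : ℕ) (f g : gl F k × gl F l → ℂ) : ℂ :=
  ((Fintype.card (Matrix.GeneralLinearGroup (Fin k) F) *
      Fintype.card (Matrix.GeneralLinearGroup (Fin l) F) : ℂ))⁻¹ *
    ∑ p : gl F k × gl F l, f p * (starRingEnd ℂ) (g p)

/-- `f ∈ C_n` is pre-cuspidal if all proper Harish-Chandra restrictions of `f` vanish. -/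
def PreCuspidal (n : ℕ) (f : gl F n → ℂ) : Prop :=
  ∀ (k l : ℕ), 1 ≤ k → 1 ≤ l → ∀ hkl : k + l = n, HCres k l (castFun hkl.symm f) = 0

/-- The composite `R_{(n_1,…,n_r)} ∘ *R_{(n_1,…,n_r)}` of the iterated two-block
Harish-Chandra induction and restriction along the composition `(n_1,…,n_r)`. -/
noncomputable def RcompRes : (L : List ℕ) → (gl F L.sum → ℂ) → gl F L.sum → ℂ
  | [], f => f
  | (k :: L), f =>
      castFun (List.sum_cons).symm
        (HCind k L.sum fun p =>
          RcompRes L (fun y => HCres k L.sum (castFun List.sum_cons f) (p.1, y)) p.2)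

/-- The duality operation `𝒟_n(f) = Σ_{(n_1,…,n_r) ⊨ n} (-1)^{n-r}
R_{(n_1,…,n_r)}(*R_{(n_1,…,n_r)} f)`, the sum over all compositions of `n`. -/
noncomputable def Dual (n : ℕ) (f : gl F n → ℂ) : gl F n → ℂ :=
  ∑ c : Composition n,
    ((-1 : ℂ)) ^ (n - c.length) •
      castFun c.blocks_sum (RcompRes c.blocks (castFun c.blocks_sum.symm f))

/-- `C_n`, the subspace of invariant functions, as a `ℂ`-submodule of all functions. -/
noncomputable def InvSub (F : Type) [Field F] (n : ℕ) : Submodule ℂ (gl F n → ℂ) where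
  carrier := {f | Invariant n f}
  add_mem' := by
    intro a b ha hb g x
    simp only [Pi.add_apply]
    rw [ha g x, hb g x]
  zero_mem' := by intro g x; rfl
  smul_mem' := by
    intro c f hf g x
    simp only [Pi.smul_apply]
    rw [hf g x]

/-- `χ` is the character of a finite-dimensional complex representation of the
additive group `gl_n(F)`. -/
def IsChar (n : ℕ) (χ : gl F n → ℂ) : Prop :=
  ∃ V : FDRep ℂ (Multiplicative (gl F n)),
    ∀ x : gl F n, FDRep.character V (Multiplicative.ofAdd x) = χ x

/-- An invariant character of `gl_n(F)`. -/
def IsInvChar (n : ℕ) (χ : gl F n → ℂ) : Prop := IsChar n χ ∧ Invariant n χ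

/-- A character of the additive group `gl_k(F) × gl_l(F)`. -/
def IsChar₂ (k l : ℕ) (χ : gl F k × gl F l → ℂ) : Prop :=
  ∃ V : FDRep ℂ (Multiplicative (gl F k × gl F l)),
    ∀ p : gl F k × gl F l, FDRep.character V (Multiplicative.ofAdd p) = χ p

/-- An invariant character of `gl_k(F) × gl_l(F)`. -/
def IsInvChar₂ (k l : ℕ) (χ : gl F k × gl F l → ℂ) : Prop := IsChar₂ k l χ ∧ Invariant₂ k l χ

/-- An irreducible invariant character: a nonzero invariant character which is not
the sum of two nonzero invariant characters. -/
def IrrInvChar (n : ℕ) (χ : gl F n → ℂ) : Prop :=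
  IsInvChar n χ ∧ χ ≠ 0 ∧
    ¬ ∃ χ₁ χ₂ : gl F n → ℂ, IsInvChar n χ₁ ∧ IsInvChar n χ₂ ∧ χ₁ ≠ 0 ∧ χ₂ ≠ 0 ∧ χ = χ₁ + χ₂


end HCPaper

namespace HCAux

open scoped Classical

variable {F : Type} [Field F]

/-- A finite vector space with an endomorphism. -/
structure Obj (F : Type) [Field F] where
  V : Type
  [ac : AddCommGroup V]
  [md : Module F V]
  [fn : Finite V]
  z : V →ₗ[F] V

attribute [instance] Obj.ac Obj.md Obj.fn

noncomputable instance instFintypeSub {V : Type} [AddCommGroup V] [Module F V] [Finite V] :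
    Fintype (Submodule F V) := Fintype.ofFinite _

theorem finite_hom {V W : Type} [AddCommGroup V] [Module F V] [Finite V]
    [AddCommGroup W] [Module F W] [Finite W] : Finite (V →ₗ[F] W) :=
  Finite.of_injective (fun f : V →ₗ[F] W => (f : V → W)) DFunLike.coe_injective

noncomputable instance instFintypeHom {V W : Type} [AddCommGroup V] [Module F V] [Finite V]
    [AddCommGroup W] [Module F W] [Finite W] : Fintype (V →ₗ[F] W) :=
  @Fintype.ofFinite _ finite_hom

namespace Obj

/-- Isomorphism of objects. -/
def Iso (M M' : Obj F) : Prop := ∃ e : M.V ≃ₗ[F] M'.V, ∀ v, e (M.z v) = M'.z (e v)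

theorem Iso.refl (M : Obj F) : Iso M M := ⟨LinearEquiv.refl _ _, fun _ => rfl⟩

theorem Iso.symm {M M' : Obj F} (h : Iso M M') : Iso M' M := by
  obtain ⟨e, he⟩ := h
  refine ⟨e.symm, fun v => ?_⟩
  rw [LinearEquiv.symm_apply_eq, he, LinearEquiv.apply_symm_apply]

theorem Iso.trans {M M' M'' : Obj F} (h : Iso M M') (h' : Iso M' M'') : Iso M M'' := by
  obtain ⟨e, he⟩ := h
  obtain ⟨e', he'⟩ := h'
  refine ⟨e.trans e', fun v => ?_⟩
  simp [he, he']

/-- Dimension. -/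
noncomputable def dim (M : Obj F) : ℕ := Module.finrank F M.V

theorem Iso.dim_eq {M M' : Obj F} (h : Iso M M') : M.dim = M'.dim := by
  obtain ⟨e, -⟩ := h
  exact e.finrank_eq

/-- Stable subspaces. -/
abbrev St (M : Obj F) : Type := {N : Submodule F M.V // ∀ v ∈ N, M.z v ∈ N}

noncomputable instance (M : Obj F) : Fintype M.St := Fintype.ofFinite _

/-- Subobject. -/
def sub (M : Obj F) (N : M.St) : Obj F := ⟨N.1, M.z.restrict N.2⟩

/-- Quotient object. -/
def quo (M : Obj F) (N : M.St) : Obj F :=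
  { V := M.V ⧸ N.1
    fn := Finite.of_surjective _ (Submodule.mkQ_surjective N.1)
    z := N.1.mapQ N.1 M.z N.2 }

theorem quo_z (M : Obj F) (N : M.St) (v : M.V) :
    (M.quo N).z (N.1.mkQ v) = N.1.mkQ (M.z v) := rfl

theorem sub_z (M : Obj F) (N : M.St) (v : N.1) :
    ((M.sub N).z v : N.1) = ⟨M.z v.1, N.2 _ v.2⟩ := rfl

/-- projection -/
def qmap (M : Obj F) (N : M.St) : M.V →ₗ[F] (M.quo N).V := N.1.mkQ

/-- inclusion -/
def smap (M : Obj F) (N : M.St) : (M.sub N).V →ₗ[F] M.V := N.1.subtype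

theorem qmap_surj (M : Obj F) (N : M.St) : Function.Surjective (M.qmap N) :=
  Submodule.mkQ_surjective N.1

theorem qmap_z (M : Obj F) (N : M.St) (v : M.V) :
    M.qmap N (M.z v) = (M.quo N).z (M.qmap N v) := rfl

theorem qmap_eq_zero (M : Obj F) (N : M.St) (v : M.V) : M.qmap N v = 0 ↔ v ∈ N.1 :=
  Submodule.Quotient.mk_eq_zero N.1

theorem smap_inj (M : Obj F) (N : M.St) : Function.Injective (M.smap N) :=
  Subtype.val_injective

theorem smap_z (M : Obj F) (N : M.St) (v : (M.sub N).V) :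
    M.smap N ((M.sub N).z v) = M.z (M.smap N v) := rfl

theorem smap_mem (M : Obj F) (N : M.St) (v : (M.sub N).V) : M.smap N v ∈ N.1 := Subtype.prop v

theorem exists_smap (M : Obj F) (N : M.St) {m : M.V} (h : m ∈ N.1) : ∃ v, M.smap N v = m :=
  ⟨⟨m, h⟩, rfl⟩

theorem dim_sub_add_quo (M : Obj F) (N : M.St) : (M.quo N).dim + (M.sub N).dim = M.dim :=
  Submodule.finrank_quotient_add_finrank N.1

theorem sub_iso {A M : Obj F} (N : M.St) (φ : A.V →ₗ[F] M.V) (hi : Function.Injective φ)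
    (hz : ∀ v, φ (A.z v) = M.z (φ v)) (hr : ∀ m, m ∈ N.1 ↔ ∃ v, φ v = m) : Iso A (M.sub N) := by
  refine ⟨LinearEquiv.ofBijective (φ.codRestrict N.1 fun c => (hr _).2 ⟨c, rfl⟩) ⟨?_, ?_⟩, ?_⟩
  · intro a b hab
    exact hi (congrArg Subtype.val hab)
  · rintro ⟨m, hm⟩
    obtain ⟨v, hv⟩ := (hr m).1 hm
    exact ⟨v, Subtype.ext hv⟩
  · intro v
    exact Subtype.ext (hz v)

theorem quo_iso {M B : Obj F} (N : M.St) (ψ : M.V →ₗ[F] B.V) (hs : Function.Surjective ψ)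
    (hz : ∀ v, ψ (M.z v) = B.z (ψ v)) (hk : ∀ m, m ∈ N.1 ↔ ψ m = 0) : Iso (M.quo N) B := by
  have hker : N.1 = LinearMap.ker ψ := by
    ext m; rw [hk, LinearMap.mem_ker]
  refine ⟨LinearEquiv.ofBijective (N.1.liftQ ψ hker.le) ⟨?_, ?_⟩, ?_⟩
  · rw [← LinearMap.ker_eq_bot]
    exact Submodule.ker_liftQ_eq_bot _ _ _ hker.ge
  · intro b
    obtain ⟨m, rfl⟩ := hs b
    exact ⟨N.1.mkQ m, Submodule.liftQ_apply _ _ _⟩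
  · intro v
    obtain ⟨m, rfl⟩ := Submodule.mkQ_surjective N.1 v
    exact hz m

/-- Transport of stable subspaces along an isomorphism. -/
def stEquiv {M M' : Obj F} (e : M.V ≃ₗ[F] M'.V) (he : ∀ v, e (M.z v) = M'.z (e v)) :
    M.St ≃ M'.St where
  toFun N := ⟨N.1.map (e : M.V →ₗ[F] M'.V), by
    rintro _ ⟨v, hv, rfl⟩
    exact ⟨M.z v, N.2 v hv, he v⟩⟩
  invFun N := ⟨N.1.comap (e : M.V →ₗ[F] M'.V), by
    intro v hv
    have := N.2 _ hv
    simp only [Submodule.mem_comap, LinearEquiv.coe_coe] at this ⊢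
    rw [he]; exact this⟩
  left_inv N := Subtype.ext (Submodule.comap_map_eq_of_injective e.injective _)
  right_inv N := Subtype.ext (Submodule.map_comap_eq_of_surjective e.surjective _)

theorem sub_stEquiv {M M' : Obj F} (e : M.V ≃ₗ[F] M'.V) (he : ∀ v, e (M.z v) = M'.z (e v))
    (N : M.St) : Iso (M.sub N) (M'.sub (stEquiv e he N)) := by
  refine sub_iso _ ((e : M.V →ₗ[F] M'.V) ∘ₗ N.1.subtype) ?_ ?_ ?_
  · exact e.injective.comp Subtype.val_injective
  · intro v
    exact he v.1
  · intro m
    constructor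
    · rintro ⟨v, hv, rfl⟩
      exact ⟨⟨v, hv⟩, rfl⟩
    · rintro ⟨v, rfl⟩
      exact ⟨v.1, v.2, rfl⟩

theorem quo_stEquiv {M M' : Obj F} (e : M.V ≃ₗ[F] M'.V) (he : ∀ v, e (M.z v) = M'.z (e v))
    (N : M.St) : Iso (M.quo N) (M'.quo (stEquiv e he N)) := by
  refine quo_iso (B := M'.quo (stEquiv e he N)) _
    (M'.qmap (stEquiv e he N) ∘ₗ (e : M.V →ₗ[F] M'.V)) ?_ ?_ ?_
  · exact (qmap_surj _ _).comp e.surjective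
  · intro v
    rw [LinearMap.comp_apply, LinearEquiv.coe_coe, he]; rfl
  · intro m
    rw [LinearMap.comp_apply, qmap_eq_zero]
    constructor
    · intro hm; exact ⟨m, hm, rfl⟩
    · rintro ⟨v, hv, h⟩
      exact e.injective h ▸ hv

/-- the zero stable subspace -/
def bot (M : Obj F) : M.St := ⟨⊥, by simp⟩

/-- the full stable subspace -/
def top (M : Obj F) : M.St := ⟨⊤, by simp⟩

theorem quo_bot (M : Obj F) : Iso (M.quo M.bot) M :=
  quo_iso _ LinearMap.id Function.surjective_id (fun _ => rfl) (fun m => by simp [bot])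

theorem sub_top (M : Obj F) : Iso M (M.sub M.top) :=
  sub_iso _ LinearMap.id Function.injective_id (fun _ => rfl) (fun m => by simp [top])

theorem eq_bot_of_dim {M : Obj F} {N : M.St} (h : (M.sub N).dim = 0) : N = M.bot :=
  Subtype.ext (Submodule.finrank_eq_zero.1 h)

theorem dim_sub_bot (M : Obj F) : (M.sub M.bot).dim = 0 := finrank_bot F M.V

theorem dim_quo_bot (M : Obj F) : (M.quo M.bot).dim = M.dim := (quo_bot M).dim_eq

theorem eq_top_of_dim {M : Obj F} {N : M.St} (h : (M.quo N).dim = 0) : N = M.top := by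
  apply Subtype.ext
  apply Submodule.eq_top_of_finrank_eq
  have := dim_sub_add_quo M N
  rw [h, zero_add] at this
  exact this

theorem dim_sub_top (M : Obj F) : (M.sub M.top).dim = M.dim := (sub_top M).dim_eq.symm

theorem dim_quo_top (M : Obj F) : (M.quo M.top).dim = 0 := by
  have := dim_sub_add_quo M M.top
  rw [dim_sub_top] at this
  omega

theorem dim_quo_lt {M : Obj F} {N : M.St} (h : N ≠ M.bot) : (M.quo N).dim < M.dim := by
  have := dim_sub_add_quo M N
  have : (M.sub N).dim ≠ 0 := fun h' => h (eq_bot_of_dim h')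
  omega

theorem dim_sub_lt {M : Obj F} {N : M.St} (h : N ≠ M.top) : (M.sub N).dim < M.dim := by
  have := dim_sub_add_quo M N
  have : (M.quo N).dim ≠ 0 := fun h' => h (eq_top_of_dim h')
  omega

theorem iso_of_dim_zero {M M' : Obj F} (h : M.dim = 0) (h' : M'.dim = 0) : Iso M M' := by
  have h1 : Subsingleton M.V := Module.finrank_zero_iff.1 h
  have h2 : Subsingleton M'.V := Module.finrank_zero_iff.1 h'
  exact ⟨LinearEquiv.ofFinrankEq _ _ (h.trans h'.symm), fun v => Subsingleton.elim _ _⟩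

/-! ### Hall product -/

/-- class functions -/
def Inv (f : Obj F → ℂ) : Prop := ∀ M M' : Obj F, Iso M M' → f M = f M'

/-- Hall product -/
noncomputable def mul (a b : Obj F → ℂ) : Obj F → ℂ :=
  fun M => ∑ N : M.St, a (M.sub N) * b (M.quo N)

theorem sum_iso {Φ : Obj F → Obj F → ℂ} (h1 : ∀ A A' B, Iso A A' → Φ A B = Φ A' B)
    (h2 : ∀ A B B', Iso B B' → Φ A B = Φ A B') {M M' : Obj F} (h : Iso M M') :
    ∑ N : M.St, Φ (M.sub N) (M.quo N) = ∑ N : M'.St, Φ (M'.sub N) (M'.quo N) := by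
  obtain ⟨e, he⟩ := h
  refine Fintype.sum_equiv (stEquiv e he) _ _ fun N => ?_
  rw [h1 _ _ _ (sub_stEquiv e he N), h2 _ _ _ (quo_stEquiv e he N)]

theorem mul_inv {a b : Obj F → ℂ} (ha : Inv a) (hb : Inv b) : Inv (mul a b) := by
  intro M M' h
  refine sum_iso (Φ := fun A B => a A * b B) ?_ ?_ h
  · intro A A' B h; rw [ha _ _ h]
  · intro A B B' h; rw [hb _ _ h]

/-- stable subspaces of a subobject -/
def stSub (M : Obj F) (B : M.St) : (M.sub B).St ≃ {A : M.St // A.1 ≤ B.1} where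
  toFun N := ⟨⟨N.1.map B.1.subtype, by
    rintro _ ⟨v, hv, rfl⟩
    exact ⟨_, N.2 v hv, rfl⟩⟩, Submodule.map_subtype_le _ _⟩
  invFun A := ⟨A.1.1.comap B.1.subtype, fun v hv => A.1.2 _ hv⟩
  left_inv N := Subtype.ext (Submodule.comap_map_eq_of_injective Subtype.val_injective _)
  right_inv A := by
    apply Subtype.ext; apply Subtype.ext
    change Submodule.map B.1.subtype (Submodule.comap B.1.subtype A.1.1) = A.1.1
    rw [Submodule.map_comap_subtype]
    exact inf_eq_right.2 A.2

/-- stable subspaces of a quotient -/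
def stQuo (M : Obj F) (A : M.St) : (M.quo A).St ≃ {B : M.St // A.1 ≤ B.1} where
  toFun N := ⟨⟨N.1.comap A.1.mkQ, fun v hv => N.2 _ hv⟩, by
    intro v hv
    have : A.1.mkQ v = 0 := by simpa using hv
    change A.1.mkQ v ∈ N.1
    rw [this]; exact N.1.zero_mem⟩
  invFun B := ⟨B.1.1.map A.1.mkQ, by
    rintro _ ⟨v, hv, rfl⟩
    exact ⟨_, B.1.2 v hv, rfl⟩⟩
  left_inv N := Subtype.ext (Submodule.map_comap_eq_of_surjective (Submodule.mkQ_surjective _) _)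
  right_inv B := by
    apply Subtype.ext; apply Subtype.ext
    change Submodule.comap A.1.mkQ (Submodule.map A.1.mkQ B.1.1) = B.1.1
    rw [Submodule.comap_map_mkQ]
    exact sup_eq_right.2 B.2

/-- swap -/
def swapSt (M : Obj F) : (Σ B : M.St, {A : M.St // A.1 ≤ B.1}) ≃
    (Σ A : M.St, {B : M.St // A.1 ≤ B.1}) where
  toFun p := ⟨p.2.1, p.1, p.2.2⟩
  invFun p := ⟨p.2.1, p.1, p.2.2⟩
  left_inv _ := rfl
  right_inv _ := rfl

theorem iso_sub_sub (M : Obj F) (A B : M.St) (h : A.1 ≤ B.1) :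
    Iso ((M.sub B).sub ((stSub M B).symm ⟨A, h⟩)) (M.sub A) := by
  refine sub_iso _ (B.1.subtype ∘ₗ ((stSub M B).symm ⟨A, h⟩).1.subtype) ?_ ?_ ?_
  · exact Subtype.val_injective.comp Subtype.val_injective
  · intro v; rfl
  · intro m
    constructor
    · intro hm; exact ⟨⟨⟨m, h hm⟩, hm⟩, rfl⟩
    · rintro ⟨v, rfl⟩; exact v.2

theorem iso_quo_quo (M : Obj F) (A B : M.St) (h : A.1 ≤ B.1) :
    Iso (M.quo B) ((M.quo A).quo ((stQuo M A).symm ⟨B, h⟩)) := by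
  refine quo_iso (B := (M.quo A).quo ((stQuo M A).symm ⟨B, h⟩)) _
    ((M.quo A).qmap ((stQuo M A).symm ⟨B, h⟩) ∘ₗ M.qmap A) ?_ ?_ ?_
  · exact (qmap_surj _ _).comp (qmap_surj _ _)
  · intro v; rfl
  · intro m
    rw [LinearMap.comp_apply, qmap_eq_zero]
    change m ∈ B.1 ↔ m ∈ (stQuo M A ((stQuo M A).symm ⟨B, h⟩)).1.1
    rw [Equiv.apply_symm_apply]

theorem iso_sub_quo (M : Obj F) (A B : M.St) (h : A.1 ≤ B.1) :
    Iso ((M.sub B).quo ((stSub M B).symm ⟨A, h⟩)) ((M.quo A).sub ((stQuo M A).symm ⟨B, h⟩)) := by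
  refine quo_iso (B := (M.quo A).sub ((stQuo M A).symm ⟨B, h⟩)) _
    ((M.qmap A ∘ₗ M.smap B).codRestrict ((stQuo M A).symm ⟨B, h⟩).1
      fun c => ⟨c.1, c.2, rfl⟩) ?_ ?_ ?_
  · rintro ⟨_, ⟨b, hb, rfl⟩⟩
    exact ⟨⟨b, hb⟩, rfl⟩
  · intro v; rfl
  · intro m
    refine Iff.trans (qmap_eq_zero M A m.1).symm ?_
    exact ⟨fun h => Subtype.ext h, fun h => congrArg Subtype.val h⟩

theorem assoc_sum {Φ : Obj F → Obj F → Obj F → ℂ}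
    (h1 : ∀ A A' B C, Iso A A' → Φ A B C = Φ A' B C)
    (h2 : ∀ A B B' C, Iso B B' → Φ A B C = Φ A B' C)
    (h3 : ∀ A B C C', Iso C C' → Φ A B C = Φ A B C') (M : Obj F) :
    ∑ N : M.St, ∑ N₁ : (M.sub N).St, Φ ((M.sub N).sub N₁) ((M.sub N).quo N₁) (M.quo N) =
    ∑ N : M.St, ∑ K : (M.quo N).St, Φ (M.sub N) ((M.quo N).sub K) ((M.quo N).quo K) := by
  have e1 : ∀ N : M.St, ∑ N₁ : (M.sub N).St,
      Φ ((M.sub N).sub N₁) ((M.sub N).quo N₁) (M.quo N) =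
      ∑ A : {A : M.St // A.1 ≤ N.1},
        Φ (M.sub A.1) ((M.quo A.1).sub ((stQuo M A.1).symm ⟨N, A.2⟩)) (M.quo N) := by
    intro N
    refine (Fintype.sum_equiv (stSub M N).symm _ _ fun A => ?_).symm
    rw [h1 _ _ _ _ (iso_sub_sub M A.1 N A.2), h2 _ _ _ _ (iso_sub_quo M A.1 N A.2)]
  have e2 : ∀ A : M.St, ∑ K : (M.quo A).St,
      Φ (M.sub A) ((M.quo A).sub K) ((M.quo A).quo K) =
      ∑ B : {B : M.St // A.1 ≤ B.1},
        Φ (M.sub A) ((M.quo A).sub ((stQuo M A).symm ⟨B.1, B.2⟩)) (M.quo B.1) := by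
    intro A
    refine (Fintype.sum_equiv (stQuo M A).symm _ _ fun B => ?_).symm
    rw [h3 _ _ _ _ (iso_quo_quo M A B.1 B.2)]
  simp_rw [e1, e2]
  rw [← Fintype.sum_sigma', ← Fintype.sum_sigma']
  exact Fintype.sum_equiv (swapSt M) _ _ fun p => rfl

end Obj

end HCAux

namespace HCAux

open scoped Classical

variable {F : Type} [Field F]

namespace Obj

/-- extension object with cocycle `u` -/
def ext (A B : Obj F) (u : B.V →ₗ[F] A.V) : Obj F where
  V := A.V × B.V
  z := LinearMap.prod (A.z ∘ₗ LinearMap.fst F A.V B.V + u ∘ₗ LinearMap.snd F A.V B.V)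
    (B.z ∘ₗ LinearMap.snd F A.V B.V)

theorem ext_z (A B : Obj F) (u : B.V →ₗ[F] A.V) (a : A.V) (b : B.V) :
    (ext A B u).z (a, b) = (A.z a + u b, B.z b) := rfl

/-- coproduct -/
noncomputable def delta (f : Obj F → ℂ) (A B : Obj F) : ℂ :=
  (Fintype.card (B.V →ₗ[F] A.V) : ℂ)⁻¹ * ∑ u : B.V →ₗ[F] A.V, f (ext A B u)

theorem dim_ext (A B : Obj F) (u : B.V →ₗ[F] A.V) : (ext A B u).dim = A.dim + B.dim :=
  Module.finrank_prod

theorem delta_iso {f : Obj F → ℂ} (hf : Inv f) {A A' B B' : Obj F} (hA : Iso A A')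
    (hB : Iso B B') : delta f A B = delta f A' B' := by
  obtain ⟨e, he⟩ := hA
  obtain ⟨e', he'⟩ := hB
  have E : (B.V →ₗ[F] A.V) ≃ (B'.V →ₗ[F] A'.V) := (LinearEquiv.arrowCongr e' e).toEquiv
  unfold delta
  rw [Fintype.card_congr E]
  congr 1
  refine Fintype.sum_equiv (LinearEquiv.arrowCongr e' e).toEquiv _ _ fun u => ?_
  refine hf _ _ ⟨e.prodCongr e', ?_⟩
  rintro ⟨a, b⟩
  change (e (A.z a + u b), e' (B.z b)) =
    (A'.z (e a) + e (u (e'.symm (e' b))), B'.z (e' b))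
  rw [map_add, he, he', LinearEquiv.symm_apply_apply]

theorem delta_inv {f : Obj F → ℂ} (hf : Inv f) (A : Obj F) : Inv (delta f A) :=
  fun _ _ h => delta_iso hf (Iso.refl A) h

theorem delta_congr_left {f : Obj F → ℂ} (hf : Inv f) {A A' : Obj F} (h : Iso A A') :
    delta f A = delta f A' := funext fun B => delta_iso hf h (Iso.refl B)

theorem delta_zero_left {f : Obj F → ℂ} (hf : Inv f) {A : Obj F} (h : A.dim = 0) :
    delta f A = f := by
  funext B
  have h1 : Subsingleton A.V := Module.finrank_zero_iff.1 h
  have : Subsingleton (B.V →ₗ[F] A.V) := ⟨fun f g => LinearMap.ext fun _ => Subsingleton.elim _ _⟩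
  unfold delta
  rw [Fintype.sum_subsingleton _ 0, Fintype.card_eq_one_iff_nonempty_unique.2
    ⟨⟨⟨0⟩, fun _ => Subsingleton.elim _ _⟩⟩]
  simp only [Nat.cast_one, inv_one, one_mul]
  refine hf _ _ ⟨LinearEquiv.ofBijective (LinearMap.snd F A.V B.V) ⟨?_, ?_⟩, ?_⟩
  · rintro ⟨a, b⟩ ⟨a', b'⟩ hh
    exact Prod.ext (Subsingleton.elim _ _) hh
  · intro b; exact ⟨(0, b), rfl⟩
  · intro v; rfl

theorem delta_zero_right {f : Obj F → ℂ} (hf : Inv f) (A : Obj F) {B : Obj F} (h : B.dim = 0) :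
    delta f A B = f A := by
  have h1 : Subsingleton B.V := Module.finrank_zero_iff.1 h
  have : Subsingleton (B.V →ₗ[F] A.V) := ⟨fun f g => LinearMap.ext fun x => by
    rw [Subsingleton.elim x 0, map_zero, map_zero]⟩
  unfold delta
  rw [Fintype.sum_subsingleton _ 0, Fintype.card_eq_one_iff_nonempty_unique.2
    ⟨⟨⟨0⟩, fun _ => Subsingleton.elim _ _⟩⟩]
  simp only [Nat.cast_one, inv_one, one_mul]
  refine hf _ _ ⟨LinearEquiv.ofBijective (LinearMap.fst F A.V B.V) ⟨?_, ?_⟩, ?_⟩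
  · rintro ⟨a, b⟩ ⟨a', b'⟩ hh
    exact Prod.ext hh (Subsingleton.elim _ _)
  · intro b; exact ⟨(b, 0), rfl⟩
  · intro v
    change A.z v.1 + (0 : B.V →ₗ[F] A.V) v.2 = A.z v.1
    simp

theorem delta_add (f g : Obj F → ℂ) (A : Obj F) : delta (f + g) A = delta f A + delta g A := by
  funext B
  simp [delta, Finset.sum_add_distrib, mul_add]

theorem delta_smul (c : ℂ) (f : Obj F → ℂ) (A : Obj F) : delta (c • f) A = c • delta f A := by
  funext B
  simp only [delta, Pi.smul_apply, smul_eq_mul, ← Finset.mul_sum]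
  ring

/-- the antipode -/
noncomputable def S (f : Obj F → ℂ) (M : Obj F) : ℂ :=
  if M.dim = 0 then f M else
    - ∑ N : {N : M.St // N ≠ M.bot}, S (delta f (M.sub N.1)) (M.quo N.1)
termination_by M.dim
decreasing_by exact dim_quo_lt N.2

theorem S_dim_zero (f : Obj F → ℂ) {M : Obj F} (h : M.dim = 0) : S f M = f M := by
  rw [S, if_pos h]

theorem S_dim_pos (f : Obj F → ℂ) {M : Obj F} (h : M.dim ≠ 0) : S f M =
    - ∑ N : {N : M.St // N ≠ M.bot}, S (delta f (M.sub N.1)) (M.quo N.1) := by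
  rw [S, if_neg h]

theorem S_congr_dim (n : ℕ) : ∀ (f g : Obj F → ℂ), (∀ M : Obj F, M.dim = n → f M = g M) →
    ∀ M : Obj F, M.dim = n → S f M = S g M := by
  induction n using Nat.strong_induction_on with
  | _ n ih =>
    intro f g h M hM
    by_cases h0 : M.dim = 0
    · rw [S_dim_zero _ h0, S_dim_zero _ h0, h M hM]
    · rw [S_dim_pos _ h0, S_dim_pos _ h0]
      congr 1
      refine Finset.sum_congr rfl fun N _ => ?_
      refine ih (M.quo N.1).dim (hM ▸ dim_quo_lt N.2) _ _ ?_ _ rfl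
      intro W hW
      unfold delta
      congr 1
      refine Finset.sum_congr rfl fun u _ => h _ ?_
      rw [dim_ext, hW, ← hM, ← dim_sub_add_quo M N.1]; ring

theorem S_add_aux (n : ℕ) : ∀ (f g : Obj F → ℂ) (M : Obj F), M.dim = n →
    S (f + g) M = S f M + S g M := by
  induction n using Nat.strong_induction_on with
  | _ n ih =>
    intro f g M hM
    by_cases h0 : M.dim = 0
    · rw [S_dim_zero _ h0, S_dim_zero _ h0, S_dim_zero _ h0]; rfl
    · rw [S_dim_pos _ h0, S_dim_pos _ h0, S_dim_pos _ h0, ← neg_add, ← Finset.sum_add_distrib]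
      congr 1
      refine Finset.sum_congr rfl fun N _ => ?_
      rw [delta_add]
      exact ih (M.quo N.1).dim (hM ▸ dim_quo_lt N.2) _ _ _ rfl

theorem S_add (f g : Obj F → ℂ) : S (f + g) = S f + S g :=
  funext fun M => S_add_aux _ f g M rfl

theorem S_smul_aux (n : ℕ) : ∀ (c : ℂ) (f : Obj F → ℂ) (M : Obj F), M.dim = n →
    S (c • f) M = c * S f M := by
  induction n using Nat.strong_induction_on with
  | _ n ih =>
    intro c f M hM
    by_cases h0 : M.dim = 0
    · rw [S_dim_zero _ h0, S_dim_zero _ h0]; rfl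
    · rw [S_dim_pos _ h0, S_dim_pos _ h0, mul_neg, Finset.mul_sum]
      congr 1
      refine Finset.sum_congr rfl fun N _ => ?_
      rw [delta_smul]
      exact ih (M.quo N.1).dim (hM ▸ dim_quo_lt N.2) _ _ _ rfl

theorem S_smul (c : ℂ) (f : Obj F → ℂ) : S (c • f) = c • S f :=
  funext fun M => S_smul_aux _ c f M rfl

theorem S_zero : S (0 : Obj F → ℂ) = 0 := by
  have := S_smul 0 (0 : Obj F → ℂ)
  simpa using this

theorem S_sum {ι : Type} (s : Finset ι) (f : ι → Obj F → ℂ) :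
    S (∑ i ∈ s, f i) = ∑ i ∈ s, S (f i) := by
  induction s using Finset.induction_on with
  | empty => simpa using S_zero
  | insert a s ha ih => rw [Finset.sum_insert ha, Finset.sum_insert ha, S_add, ih]

theorem S_inv_aux (n : ℕ) : ∀ (f : Obj F → ℂ), Inv f → ∀ (M M' : Obj F), M.dim = n → Iso M M' →
    S f M = S f M' := by
  induction n using Nat.strong_induction_on with
  | _ n ih =>
    intro f hf M M' hM h
    have hd := h.dim_eq
    by_cases h0 : M.dim = 0
    · rw [S_dim_zero _ h0, S_dim_zero _ (hd ▸ h0), hf _ _ h]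
    · rw [S_dim_pos _ h0, S_dim_pos _ (hd ▸ h0)]
      congr 1
      obtain ⟨e, he⟩ := h
      refine Fintype.sum_equiv ((stEquiv e he).subtypeEquiv fun N => ?_) _ _ fun N => ?_
      · rw [not_iff_not]
        constructor
        · rintro rfl; exact Subtype.ext (Submodule.map_bot _)
        · intro h
          apply eq_bot_of_dim
          rw [(sub_stEquiv e he N).dim_eq, h, dim_sub_bot]
      · change _ = S (delta f (M'.sub (stEquiv e he N.1))) (M'.quo (stEquiv e he N.1))
        rw [← delta_congr_left hf (sub_stEquiv e he N.1)]
        exact ih (M.quo N.1).dim (hM ▸ dim_quo_lt N.2) _ (delta_inv hf _) _ _ rfl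
          (quo_stEquiv e he N.1)

theorem S_inv {f : Obj F → ℂ} (hf : Inv f) : Inv (S f) :=
  fun M M' h => S_inv_aux _ f hf M M' rfl h

/-- `id * S = ε`. -/
theorem S_rec {f : Obj F → ℂ} (hf : Inv f) (M : Obj F) :
    ∑ N : M.St, S (delta f (M.sub N)) (M.quo N) = if M.dim = 0 then f M else 0 := by
  have hb : S (delta f (M.sub M.bot)) (M.quo M.bot) = S f M := by
    rw [delta_zero_left hf (dim_sub_bot M)]
    exact S_inv hf _ _ (quo_bot M)
  have hsplit : ∑ N : M.St, S (delta f (M.sub N)) (M.quo N) = S f M +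
      ∑ N : {N : M.St // N ≠ M.bot}, S (delta f (M.sub N.1)) (M.quo N.1) := by
    rw [← hb, Fintype.sum_eq_add_sum_subtype_ne (fun N => S (delta f (M.sub N)) (M.quo N)) M.bot]
  rw [hsplit]
  by_cases h0 : M.dim = 0
  · rw [if_pos h0, S_dim_zero _ h0]
    have : IsEmpty {N : M.St // N ≠ M.bot} := ⟨fun N => by
      have := dim_quo_lt N.2
      omega⟩
    simp
  · rw [if_neg h0, S_dim_pos _ h0]; ring

end Obj

end HCAux

namespace HCAux

open scoped Classical

variable {F : Type} [Field F]

theorem sum_subtype_dite {ι : Type} [Fintype ι] (p : ι → Prop) [Fintype {i // p i}]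
    (g : {i // p i} → ℂ) : ∑ i : {i // p i}, g i = ∑ i, if h : p i then g ⟨i, h⟩ else 0 := by
  refine Fintype.sum_of_injective Subtype.val Subtype.val_injective _ _ ?_ ?_
  · intro i hi
    rw [dif_neg]
    intro h
    exact hi ⟨⟨i, h⟩, rfl⟩
  · intro i
    rw [dif_pos i.2]

theorem avg_surj {H K : Type} [AddGroup H] [AddGroup K] [Fintype H] [Fintype K] (π : H →+ K)
    (hπ : Function.Surjective π) (g : K → ℂ) :
    (Fintype.card H : ℂ)⁻¹ * ∑ h, g (π h) = (Fintype.card K : ℂ)⁻¹ * ∑ k, g k := by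
  have hc : ∀ k : K, (Finset.univ.filter fun h => π h = k).card =
      (Finset.univ.filter fun h => π h = 0).card := fun k =>
    AddMonoidHom.card_fiber_eq_of_mem_range π (hπ k) (hπ 0)
  set c := (Finset.univ.filter fun h => π h = 0).card with hcdef
  have h1 : ∑ h, g (π h) = c * ∑ k, g k := by
    rw [← Finset.sum_fiberwise (s := Finset.univ) (g := π), Finset.mul_sum]
    refine Finset.sum_congr rfl fun k _ => ?_
    rw [← hc k, Finset.card_eq_sum_ones, Nat.cast_sum, Finset.sum_mul]
    refine Finset.sum_congr rfl fun h hh => ?_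
    rw [(Finset.mem_filter.1 hh).2]; simp
  have h2 : Fintype.card H = c * Fintype.card K := by
    rw [← Finset.card_univ, Finset.card_eq_sum_card_fiberwise (f := π) (t := Finset.univ)
      (by simp), Finset.sum_congr rfl fun k _ => hc k]
    simp [mul_comm]
  have hc0 : (c : ℂ) ≠ 0 := by
    have : Fintype.card H ≠ 0 := Fintype.card_ne_zero
    rw [h2] at this
    exact_mod_cast left_ne_zero_of_mul this
  rw [h1, h2]
  push_cast
  have hK : (Fintype.card K : ℂ) ≠ 0 := by exact_mod_cast Fintype.card_ne_zero
  field_simp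

section shear

variable {V W : Type} [AddCommGroup V] [Module F V] [AddCommGroup W] [Module F W]

/-- shear -/
def sh (φ : W →ₗ[F] V) : (V × W) ≃ₗ[F] (V × W) where
  toFun p := (p.1 + φ p.2, p.2)
  invFun p := (p.1 - φ p.2, p.2)
  map_add' p q := by ext <;> simp; abel
  map_smul' c p := by ext <;> simp
  left_inv p := by ext <;> simp
  right_inv p := by ext <;> simp

theorem mem_map_sh (φ : W →ₗ[F] V) (A : Submodule F V) (B : Submodule F W) (v : V) (w : W) :
    (v, w) ∈ (A.prod B).map (sh φ : (V × W) →ₗ[F] (V × W)) ↔ v - φ w ∈ A ∧ w ∈ B := by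
  constructor
  · rintro ⟨⟨a, b⟩, ⟨ha, hb⟩, h⟩
    have h1 : a + φ b = v := congrArg Prod.fst h
    have h2 : b = w := congrArg Prod.snd h
    subst h2; subst h1
    exact ⟨by simpa using ha, hb⟩
  · rintro ⟨h1, h2⟩
    exact ⟨(v - φ w, w), ⟨h1, h2⟩, by simp [sh]⟩

theorem exists_sh (N : Submodule F (V × W)) : ∃ φ : W →ₗ[F] V,
    ((N.comap (LinearMap.inl F V W)).prod (N.map (LinearMap.snd F V W))).map
      (sh φ : (V × W) →ₗ[F] (V × W)) = N := by
  let p : N →ₗ[F] N.map (LinearMap.snd F V W) :=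
    (LinearMap.snd F V W ∘ₗ N.subtype).codRestrict _ fun c => ⟨c.1, c.2, rfl⟩
  have hp : LinearMap.range p = ⊤ := by
    rw [LinearMap.range_eq_top]
    rintro ⟨_, ⟨c, hc, rfl⟩⟩
    exact ⟨⟨c, hc⟩, rfl⟩
  obtain ⟨s, hs⟩ := p.exists_rightInverse_of_surjective hp
  obtain ⟨φ, hφ⟩ := (LinearMap.fst F V W ∘ₗ N.subtype ∘ₗ s).exists_extend
  have key : ∀ w ∈ N.map (LinearMap.snd F V W), (φ w, w) ∈ N := by
    intro w hw
    have e1 : φ w = (s ⟨w, hw⟩).1.1 := LinearMap.congr_fun hφ ⟨w, hw⟩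
    have e2 : (s ⟨w, hw⟩).1.2 = w := congrArg Subtype.val (LinearMap.congr_fun hs ⟨w, hw⟩)
    have e3 : (φ w, w) = (s ⟨w, hw⟩).1 := Prod.ext e1 e2.symm
    rw [e3]; exact (s ⟨w, hw⟩).2
  refine ⟨φ, ?_⟩
  ext ⟨v, w⟩
  rw [mem_map_sh]
  constructor
  · rintro ⟨h1, h2⟩
    have := N.add_mem h1 (key w h2)
    simpa using this
  · intro h
    have hw : w ∈ N.map (LinearMap.snd F V W) := ⟨(v, w), h, rfl⟩
    refine ⟨?_, hw⟩
    have := N.sub_mem h (key w hw)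
    simpa using this

theorem sh_inj {φ : W →ₗ[F] V} {A : Submodule F V} {B : Submodule F W} {N : Submodule F (V × W)}
    (h : (A.prod B).map (sh φ : (V × W) →ₗ[F] (V × W)) = N) :
    A = N.comap (LinearMap.inl F V W) ∧ B = N.map (LinearMap.snd F V W) := by
  subst h
  constructor
  · ext v
    rw [Submodule.mem_comap, LinearMap.inl_apply, mem_map_sh]
    simp
  · ext w
    constructor
    · intro hw
      exact ⟨(φ w, w), (mem_map_sh _ _ _ _ _).2 ⟨by simp, hw⟩, rfl⟩
    · rintro ⟨⟨v, w'⟩, hv, rfl⟩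
      exact ((mem_map_sh _ _ _ _ _).1 hv).2

noncomputable instance instFintypeCompat [Finite V] [Finite W] (A : Submodule F V)
    (B : Submodule F W) : Fintype (Submodule.compatibleMaps B A) :=
  @Fintype.ofFinite _ (@Subtype.finite _ finite_hom _)

theorem card_sh [Finite V] [Finite W] (N : Submodule F (V × W)) (A : Submodule F V)
    (B : Submodule F W) (hA : A = N.comap (LinearMap.inl F V W))
    (hB : B = N.map (LinearMap.snd F V W)) :
    Fintype.card {φ : W →ₗ[F] V // (A.prod B).map (sh φ : (V × W) →ₗ[F] (V × W)) = N} =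
    Fintype.card (Submodule.compatibleMaps B A) := by
  obtain ⟨φ₀, h₀⟩ := exists_sh N
  rw [← hA, ← hB] at h₀
  refine Fintype.card_congr ((Equiv.subRight φ₀).subtypeEquiv fun φ => ?_)
  change _ ↔ ∀ w ∈ B, (φ - φ₀) w ∈ A
  constructor
  · intro h w hw
    have h1 : (φ w, w) ∈ N := by
      rw [← h, mem_map_sh]; exact ⟨by simp, hw⟩
    rw [← h₀, mem_map_sh] at h1
    exact h1.1
  · intro h
    rw [← h₀]
    ext ⟨v, w⟩
    rw [mem_map_sh, mem_map_sh]
    refine and_congr_left fun hw => ?_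
    have := h w hw
    constructor
    · intro h1
      have := A.add_mem h1 this
      simpa using this
    · intro h1
      have := A.sub_mem h1 this
      simpa using this

theorem sum_sh [Finite V] [Finite W] (g : Submodule F (V × W) → ℂ) :
    ∑ N, g N = ∑ A : Submodule F V, ∑ B : Submodule F W,
      (Fintype.card (Submodule.compatibleMaps B A) : ℂ)⁻¹ *
        ∑ φ : W →ₗ[F] V, g ((A.prod B).map (sh φ : (V × W) →ₗ[F] (V × W))) := by
  have e : ∀ (A : Submodule F V) (B : Submodule F W),
      ∑ φ : W →ₗ[F] V, g ((A.prod B).map (sh φ : (V × W) →ₗ[F] (V × W))) =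
      ∑ N, Fintype.card {φ : W →ₗ[F] V //
        (A.prod B).map (sh φ : (V × W) →ₗ[F] (V × W)) = N} * g N := by
    intro A B
    rw [← Finset.sum_fiberwise (s := Finset.univ)
      (g := fun φ : W →ₗ[F] V => (A.prod B).map (sh φ : (V × W) →ₗ[F] (V × W)))]
    refine Finset.sum_congr rfl fun N _ => ?_
    rw [Fintype.card_subtype, Finset.card_eq_sum_ones, Nat.cast_sum, Finset.sum_mul]
    refine Finset.sum_congr rfl fun h hh => ?_
    rw [(Finset.mem_filter.1 hh).2]; simp
  simp_rw [e, Finset.mul_sum]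
  rw [Finset.sum_congr rfl fun A _ => Finset.sum_comm, Finset.sum_comm]
  refine Finset.sum_congr rfl fun N _ => ?_
  rw [Finset.sum_eq_single (N.comap (LinearMap.inl F V W)),
    Finset.sum_eq_single (N.map (LinearMap.snd F V W))]
  · rw [card_sh N _ _ rfl rfl, ← mul_assoc, inv_mul_cancel₀, one_mul]
    exact_mod_cast Fintype.card_ne_zero
  · intro B _ hB
    have : IsEmpty {φ : W →ₗ[F] V // ((N.comap (LinearMap.inl F V W)).prod B).map
        (sh φ : (V × W) →ₗ[F] (V × W)) = N} := ⟨fun φ => hB (sh_inj φ.2).2⟩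
    rw [Fintype.card_eq_zero_iff.2 this]; simp
  · simp
  · intro A _ hA
    refine Finset.sum_eq_zero fun B _ => ?_
    have : IsEmpty {φ : W →ₗ[F] V // (A.prod B).map
        (sh φ : (V × W) →ₗ[F] (V × W)) = N} := ⟨fun φ => hA (sh_inj φ.2).1⟩
    rw [Fintype.card_eq_zero_iff.2 this]; simp
  · simp

end shear

end HCAux

namespace HCAux

open scoped Classical

variable {F : Type} [Field F]

namespace Obj

/-- summand of the Hall product, extended by zero -/
noncomputable def G (a b : Obj F → ℂ) (M : Obj F) (N : Submodule F M.V) : ℂ :=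
  if h : ∀ v ∈ N, M.z v ∈ N then a (M.sub ⟨N, h⟩) * b (M.quo ⟨N, h⟩) else 0

theorem G_pos (a b : Obj F → ℂ) (M : Obj F) (N : Submodule F M.V) (h : ∀ v ∈ N, M.z v ∈ N) :
    G a b M N = a (M.sub ⟨N, h⟩) * b (M.quo ⟨N, h⟩) := dif_pos h

theorem G_neg (a b : Obj F → ℂ) (M : Obj F) (N : Submodule F M.V) (h : ¬ ∀ v ∈ N, M.z v ∈ N) :
    G a b M N = 0 := dif_neg h

theorem mul_eq_G (a b : Obj F → ℂ) (M : Obj F) : mul a b M = ∑ N, G a b M N := by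
  unfold mul G
  exact sum_subtype_dite (fun N : Submodule F M.V => ∀ v ∈ N, M.z v ∈ N)
    (fun N => a (M.sub N) * b (M.quo N))

theorem G_iso {a b : Obj F → ℂ} (ha : Inv a) (hb : Inv b) {M M' : Obj F} (e : M.V ≃ₗ[F] M'.V)
    (he : ∀ v, e (M.z v) = M'.z (e v)) (N : Submodule F M.V) :
    G a b M N = G a b M' (N.map (e : M.V →ₗ[F] M'.V)) := by
  by_cases h : ∀ v ∈ N, M.z v ∈ N
  · have h' := (stEquiv e he ⟨N, h⟩).2
    rw [G_pos _ _ _ _ h, ha _ _ (sub_stEquiv e he ⟨N, h⟩), hb _ _ (quo_stEquiv e he ⟨N, h⟩)]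
    exact (G_pos _ _ _ _ h').symm
  · rw [G_neg _ _ _ _ h, G_neg]
    intro h'
    apply h
    intro v hv
    obtain ⟨w, hw, hw'⟩ := h' (e v) ⟨v, hv, rfl⟩
    have : w = M.z v := e.injective (hw'.trans (he v).symm)
    exact this ▸ hw

theorem G_sh {a b : Obj F → ℂ} (ha : Inv a) (hb : Inv b) (A B : Obj F) (u φ : B.V →ₗ[F] A.V)
    (P : Submodule F (A.V × B.V)) :
    G a b (ext A B u) (P.map (sh φ : (A.V × B.V) →ₗ[F] (A.V × B.V))) =
    G a b (ext A B (u + (A.z ∘ₗ φ - φ ∘ₗ B.z))) P := by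
  refine (G_iso (M := ext A B (u + (A.z ∘ₗ φ - φ ∘ₗ B.z))) (M' := ext A B u) ha hb (sh φ) ?_ P).symm
  rintro ⟨x, y⟩
  change ((A.z x + (u y + (A.z (φ y) - φ (B.z y)))) + φ (B.z y), B.z y) =
    (A.z (x + φ y) + u y, B.z y)
  rw [map_add]
  congr 1
  abel

theorem stable_prod_iff (A B : Obj F) (u : B.V →ₗ[F] A.V) (P : Submodule F A.V)
    (Q : Submodule F B.V) :
    (∀ v ∈ (P.prod Q : Submodule F (A.V × B.V)), (ext A B u).z v ∈ P.prod Q) ↔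
    (∀ v ∈ P, A.z v ∈ P) ∧ (∀ v ∈ Q, B.z v ∈ Q) ∧ u ∈ Submodule.compatibleMaps Q P := by
  constructor
  · intro h
    refine ⟨fun v hv => ?_, fun v hv => ?_, fun v hv => ?_⟩
    · have := (h (v, 0) ⟨hv, Q.zero_mem⟩).1
      change A.z v + u 0 ∈ P at this
      simpa using this
    · exact (h (0, v) ⟨P.zero_mem, hv⟩).2
    · have := (h (0, v) ⟨P.zero_mem, hv⟩).1
      change A.z 0 + u v ∈ P at this
      simpa using this
  · rintro ⟨h1, h2, h3⟩ ⟨x, y⟩ ⟨hx, hy⟩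
    exact ⟨P.add_mem (h1 x hx) (h3 hy), h2 y hy⟩

/-- restriction/corestriction of compatible maps -/
def pi (A B : Obj F) (P : A.St) (Q : B.St) :
    Submodule.compatibleMaps Q.1 P.1 →+
      ((B.sub Q).V →ₗ[F] (A.sub P).V) × ((B.quo Q).V →ₗ[F] (A.quo P).V) where
  toFun u := (u.1.restrict (p := Q.1) (q := P.1) (fun _ hv => u.2 hv),
    Q.1.mapQ P.1 u.1 u.2)
  map_zero' := by
    refine Prod.ext (LinearMap.ext fun v => Subtype.ext rfl) (LinearMap.ext fun v => ?_)
    obtain ⟨v, rfl⟩ := qmap_surj B Q v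
    rfl
  map_add' u w := by
    refine Prod.ext (LinearMap.ext fun v => Subtype.ext rfl) (LinearMap.ext fun v => ?_)
    obtain ⟨v, rfl⟩ := qmap_surj B Q v
    rfl

theorem smap_pi (A B : Obj F) (P : A.St) (Q : B.St) (u : Submodule.compatibleMaps Q.1 P.1)
    (v : (B.sub Q).V) : A.smap P ((pi A B P Q u).1 v) = u.1 (B.smap Q v) := rfl

theorem qmap_pi (A B : Obj F) (P : A.St) (Q : B.St) (u : Submodule.compatibleMaps Q.1 P.1)
    (v : B.V) : (pi A B P Q u).2 (B.qmap Q v) = A.qmap P (u.1 v) := rfl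

theorem pi_surj (A B : Obj F) (P : A.St) (Q : B.St) : Function.Surjective (pi A B P Q) := by
  rintro ⟨α, β⟩
  obtain ⟨u₀, hu₀⟩ := Module.projective_lifting_property (A.qmap P) (β ∘ₗ B.qmap Q) (qmap_surj A P)
  have hu₀' : ∀ v, A.qmap P (u₀ v) = β (B.qmap Q v) := fun v => LinearMap.congr_fun hu₀ v
  have hc : ∀ v ∈ Q.1, u₀ v ∈ P.1 := by
    intro v hv
    rw [← qmap_eq_zero, hu₀', (qmap_eq_zero B Q v).2 hv, map_zero]
  obtain ⟨γ, hγ⟩ := LinearMap.exists_extend (p := Q.1)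
    (HSub.hSub (α := (B.sub Q).V →ₗ[F] (A.sub P).V) (β := (B.sub Q).V →ₗ[F] (A.sub P).V) α
      (u₀.restrict (p := Q.1) (q := P.1) hc))
  have hγ' : ∀ v : (B.sub Q).V, A.smap P (γ (B.smap Q v)) = A.smap P (α v) - u₀ (B.smap Q v) :=
    fun v => congrArg (A.smap P) (LinearMap.congr_fun hγ v)
  have hmem : u₀ + A.smap P ∘ₗ γ ∈ Submodule.compatibleMaps Q.1 P.1 := by
    intro v hv
    exact P.1.add_mem (hc v hv) (smap_mem A P _)
  refine ⟨⟨u₀ + A.smap P ∘ₗ γ, hmem⟩, Prod.ext (LinearMap.ext fun v => ?_)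
    (LinearMap.ext fun v => ?_)⟩
  · apply smap_inj A P
    rw [smap_pi]
    change u₀ (B.smap Q v) + A.smap P (γ (B.smap Q v)) = A.smap P (α v)
    rw [hγ']; abel
  · obtain ⟨v, rfl⟩ := qmap_surj B Q v
    rw [qmap_pi]
    change A.qmap P (u₀ v + A.smap P (γ v)) = β (B.qmap Q v)
    rw [map_add, hu₀', (qmap_eq_zero A P _).2 (smap_mem A P _), add_zero]

theorem G_prod {a b : Obj F → ℂ} (ha : Inv a) (hb : Inv b) (A B : Obj F) (P : A.St) (Q : B.St)
    (u : Submodule.compatibleMaps Q.1 P.1) :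
    G a b (ext A B u.1) (P.1.prod Q.1) =
      a (ext (A.sub P) (B.sub Q) (pi A B P Q u).1) *
      b (ext (A.quo P) (B.quo Q) (pi A B P Q u).2) := by
  have h := (stable_prod_iff A B u.1 P.1 Q.1).2 ⟨P.2, Q.2, u.2⟩
  refine (G_pos a b (ext A B u.1) (P.1.prod Q.1) h).trans ?_
  congr 1
  · refine (ha _ _ (sub_iso (A := ext (A.sub P) (B.sub Q) (pi A B P Q u).1)
      (M := ext A B u.1) ⟨P.1.prod Q.1, h⟩
      (LinearMap.prodMap (A.smap P) (B.smap Q)) ?_ ?_ ?_)).symm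
    · rintro ⟨x, y⟩ ⟨x', y'⟩ hh
      exact Prod.ext (smap_inj A P (congrArg Prod.fst hh)) (smap_inj B Q (congrArg Prod.snd hh))
    · rintro ⟨x, y⟩; rfl
    · rintro ⟨x, y⟩
      constructor
      · rintro ⟨hx, hy⟩
        exact ⟨(⟨x, hx⟩, ⟨y, hy⟩), rfl⟩
      · rintro ⟨⟨v, w⟩, hv⟩
        rw [← hv]
        exact ⟨smap_mem A P v, smap_mem B Q w⟩
  · refine (hb _ _ (quo_iso (B := ext (A.quo P) (B.quo Q) (pi A B P Q u).2)
      (M := ext A B u.1) ⟨P.1.prod Q.1, h⟩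
      (LinearMap.prodMap (A.qmap P) (B.qmap Q)) ?_ ?_ ?_))
    · rintro ⟨x, y⟩
      obtain ⟨x, rfl⟩ := qmap_surj A P x
      obtain ⟨y, rfl⟩ := qmap_surj B Q y
      exact ⟨(x, y), rfl⟩
    · rintro ⟨x, y⟩; rfl
    · rintro ⟨x, y⟩
      change (x ∈ P.1 ∧ y ∈ Q.1) ↔ (A.qmap P x, B.qmap Q y) = ((0 : (A.quo P).V), (0 : (B.quo Q).V))
      rw [Prod.mk.injEq, qmap_eq_zero, qmap_eq_zero]

theorem avg_G {a b : Obj F → ℂ} (ha : Inv a) (hb : Inv b) (A B : Obj F) (P : A.St) (Q : B.St) :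
    (Fintype.card (Submodule.compatibleMaps Q.1 P.1) : ℂ)⁻¹ *
      ∑ u, G a b (ext A B u) (P.1.prod Q.1) =
    delta a (A.sub P) (B.sub Q) * delta b (A.quo P) (B.quo Q) := by
  have e1 : ∑ u, G a b (ext A B u) (P.1.prod Q.1) =
      ∑ u : Submodule.compatibleMaps Q.1 P.1, (fun k : ((B.sub Q).V →ₗ[F] (A.sub P).V) ×
        ((B.quo Q).V →ₗ[F] (A.quo P).V) => a (ext (A.sub P) (B.sub Q) k.1) *
        b (ext (A.quo P) (B.quo Q) k.2)) (pi A B P Q u) := by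
    symm
    refine Fintype.sum_of_injective Subtype.val Subtype.val_injective _ _ ?_ ?_
    · intro u hu
      refine G_neg _ _ _ _ fun h => ?_
      exact hu ⟨⟨u, ((stable_prod_iff A B u P.1 Q.1).1 h).2.2⟩, rfl⟩
    · intro u
      exact (G_prod ha hb A B P Q u).symm
  rw [e1]
  refine (avg_surj (pi A B P Q) (pi_surj A B P Q) (fun k : ((B.sub Q).V →ₗ[F] (A.sub P).V) ×
        ((B.quo Q).V →ₗ[F] (A.quo P).V) => a (ext (A.sub P) (B.sub Q) k.1) *
        b (ext (A.quo P) (B.quo Q) k.2))).trans ?_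
  rw [Fintype.card_prod, Fintype.sum_prod_type]
  unfold delta
  simp_rw [← Finset.mul_sum]
  rw [← Finset.sum_mul]
  push_cast
  rw [_root_.mul_inv]; ring

/-- Mackey formula. -/
theorem mackey {a b : Obj F → ℂ} (ha : Inv a) (hb : Inv b) (A B : Obj F) :
    delta (mul a b) A B = ∑ P : A.St, ∑ Q : B.St,
      delta a (A.sub P) (B.sub Q) * delta b (A.quo P) (B.quo Q) := by
  have e1 : ∀ u, mul a b (ext A B u) = ∑ P : Submodule F A.V, ∑ Q : Submodule F B.V,
      (Fintype.card (Submodule.compatibleMaps Q P) : ℂ)⁻¹ *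
        ∑ φ : B.V →ₗ[F] A.V, G a b (ext A B (u + (A.z ∘ₗ φ - φ ∘ₗ B.z))) (P.prod Q) := by
    intro u
    rw [mul_eq_G]
    refine (sum_sh (V := A.V) (W := B.V) (fun N => G a b (ext A B u) N)).trans ?_
    refine Finset.sum_congr rfl fun P _ => Finset.sum_congr rfl fun Q _ => ?_
    congr 1
    exact Finset.sum_congr rfl fun φ _ => G_sh ha hb A B u φ _
  have e2 : ∀ (P : Submodule F A.V) (Q : Submodule F B.V),
      ∑ u : B.V →ₗ[F] A.V, ∑ φ : B.V →ₗ[F] A.V,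
        G a b (ext A B (u + (A.z ∘ₗ φ - φ ∘ₗ B.z))) (P.prod Q) =
      (Fintype.card (B.V →ₗ[F] A.V)) * ∑ u, G a b (ext A B u) (P.prod Q) := by
    intro P Q
    rw [Finset.sum_comm]
    have : ∀ φ : B.V →ₗ[F] A.V, ∑ u : B.V →ₗ[F] A.V,
        G a b (ext A B (u + (A.z ∘ₗ φ - φ ∘ₗ B.z))) (P.prod Q) =
        ∑ u, G a b (ext A B u) (P.prod Q) := fun φ =>
      Fintype.sum_equiv (Equiv.addRight (A.z ∘ₗ φ - φ ∘ₗ B.z)) _ _ fun u => rfl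
    simp_rw [this]
    rw [Finset.sum_const, Finset.card_univ, nsmul_eq_mul]
  have e3 : delta (mul a b) A B = ∑ P : Submodule F A.V, ∑ Q : Submodule F B.V,
      (Fintype.card (Submodule.compatibleMaps Q P) : ℂ)⁻¹ *
        ∑ u, G a b (ext A B u) (P.prod Q) := by
    unfold delta
    simp_rw [e1]
    rw [Finset.sum_comm, Finset.mul_sum]
    refine Finset.sum_congr rfl fun P _ => ?_
    rw [Finset.sum_comm, Finset.mul_sum]
    refine Finset.sum_congr rfl fun Q _ => ?_
    rw [← Finset.mul_sum, e2]
    have hK : (Fintype.card (B.V →ₗ[F] A.V) : ℂ) ≠ 0 := by exact_mod_cast Fintype.card_ne_zero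
    field_simp
  rw [e3]
  symm
  refine Fintype.sum_of_injective Subtype.val Subtype.val_injective _ _ ?_ ?_
  · intro P hP
    refine Finset.sum_eq_zero fun Q _ => ?_
    rw [Finset.sum_eq_zero, mul_zero]
    intro u _
    refine G_neg _ _ _ _ fun h => ?_
    exact hP ⟨⟨P, ((stable_prod_iff A B u P Q).1 h).1⟩, rfl⟩
  · intro P
    refine Fintype.sum_of_injective Subtype.val Subtype.val_injective _ _ ?_ ?_
    · intro Q hQ
      rw [Finset.sum_eq_zero, mul_zero]
      intro u _
      refine G_neg _ _ _ _ fun h => ?_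
      exact hQ ⟨⟨Q, ((stable_prod_iff A B u P.1 Q).1 h).2.1⟩, rfl⟩
    · intro Q
      exact (avg_G ha hb A B P Q).symm

end Obj

end HCAux

namespace HCAux

open scoped Classical

variable {F : Type} [Field F]

namespace Obj

theorem delta_mul {a b : Obj F → ℂ} (ha : Inv a) (hb : Inv b) (A : Obj F) :
    delta (mul a b) A = ∑ P : A.St, mul (delta a (A.sub P)) (delta b (A.quo P)) := by
  funext B
  rw [mackey ha hb, Finset.sum_apply]
  rfl

theorem mul_congr_right_iso {a b : Obj F → ℂ} (ha : Inv a) (hb : Inv b) {M M' : Obj F}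
    (h : Iso M M') : mul a b M = mul a b M' := mul_inv ha hb M M' h

theorem sum_dim_sub_zero (M : Obj F) (g : M.St → ℂ) (h : ∀ N, (M.sub N).dim ≠ 0 → g N = 0) :
    ∑ N : M.St, g N = g M.bot := by
  rw [Finset.sum_eq_single M.bot]
  · intro N _ hN
    exact h N fun h' => hN (eq_bot_of_dim h')
  · simp

theorem anti_total {a b : Obj F → ℂ} (ha : Inv a) (hb : Inv b) (M : Obj F) :
    ∑ N : M.St, ∑ P : (M.sub N).St,
      mul (S (delta b ((M.sub N).quo P))) (S (delta a ((M.sub N).sub P))) (M.quo N) =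
    if M.dim = 0 then a M * b M else 0 := by
  have hSa : ∀ A, Inv (S (delta a A)) := fun A => S_inv (delta_inv ha A)
  have hSb : ∀ A, Inv (S (delta b A)) := fun A => S_inv (delta_inv hb A)
  rw [assoc_sum (Φ := fun A B C => mul (S (delta b B)) (S (delta a A)) C)]
  · have key : ∀ (α : Obj F → ℂ), Inv α → ∀ W : Obj F,
        ∑ K : W.St, mul (S (delta b (W.sub K))) α (W.quo K) = b (M.sub M.bot) * α W := by
      intro α hα W
      unfold mul
      rw [← assoc_sum (Φ := fun A B C => S (delta b A) B * α C)]
      · simp_rw [← Finset.sum_mul, S_rec hb]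
        rw [sum_dim_sub_zero]
        · rw [if_pos (dim_sub_bot W), hb _ _ (iso_of_dim_zero (dim_sub_bot W) (dim_sub_bot M)),
            hα _ _ (quo_bot W)]
        · intro N hN
          rw [if_neg hN, zero_mul]
      · intro A A' B C h
        rw [delta_congr_left hb h]
      · intro A B B' C h
        rw [hSb A _ _ h]
      · intro A B C C' h
        rw [hα _ _ h]
    simp_rw [fun N : M.St => key _ (hSa (M.sub N)) (M.quo N)]
    rw [← Finset.mul_sum, S_rec ha]
    split_ifs with h
    · rw [hb _ M (iso_of_dim_zero (dim_sub_bot M) h), mul_comm]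
    · rw [mul_zero]
  · intro A A' B C h
    rw [delta_congr_left ha h]
  · intro A B B' C h
    rw [delta_congr_left hb h]
  · intro A B C C' h
    exact mul_inv (hSb B) (hSa A) _ _ h

theorem S_mul_aux (n : ℕ) : ∀ (a b : Obj F → ℂ), Inv a → Inv b → ∀ M : Obj F, M.dim = n →
    S (mul a b) M = mul (S b) (S a) M := by
  induction n using Nat.strong_induction_on with
  | _ n ih =>
    intro a b ha hb M hM
    have h1 := S_rec (mul_inv ha hb) M
    have h2 := anti_total ha hb M
    have h3 : (if M.dim = 0 then mul a b M else 0) = if M.dim = 0 then a M * b M else 0 := by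
      split_ifs with h
      · unfold mul
        rw [sum_dim_sub_zero]
        · rw [ha _ M (iso_of_dim_zero (dim_sub_bot M) h), hb _ _ (quo_bot M)]
        · intro N hN
          have := dim_sub_add_quo M N
          omega
      · rfl
    rw [h3, ← h2] at h1
    rw [Fintype.sum_eq_add_sum_subtype_ne _ M.bot,
      Fintype.sum_eq_add_sum_subtype_ne (fun N : M.St => ∑ P : (M.sub N).St,
      mul (S (delta b ((M.sub N).quo P))) (S (delta a ((M.sub N).sub P))) (M.quo N)) M.bot] at h1
    have h4 : ∀ N : {N : M.St // N ≠ M.bot},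
        S (delta (mul a b) (M.sub N.1)) (M.quo N.1) = ∑ P : (M.sub N.1).St,
        mul (S (delta b ((M.sub N.1).quo P))) (S (delta a ((M.sub N.1).sub P))) (M.quo N.1) := by
      intro N
      rw [delta_mul ha hb, S_sum, Finset.sum_apply]
      refine Finset.sum_congr rfl fun P _ => ?_
      exact ih _ (hM ▸ dim_quo_lt N.2) _ _ (delta_inv ha _) (delta_inv hb _) _ rfl
    simp_rw [h4] at h1
    have h5 := add_right_cancel h1
    rw [delta_zero_left (mul_inv ha hb) (dim_sub_bot M),
      S_inv (mul_inv ha hb) _ _ (quo_bot M), sum_dim_sub_zero] at h5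
    · rw [h5, delta_zero_left hb, delta_zero_left ha]
      · exact mul_inv (S_inv hb) (S_inv ha) _ _ (quo_bot M)
      · exact dim_sub_bot _
      · exact (dim_quo_bot _).trans (dim_sub_bot _)
    · intro N hN
      have := dim_sub_add_quo _ N
      have := dim_sub_bot M
      omega

theorem S_mul {a b : Obj F → ℂ} (ha : Inv a) (hb : Inv b) : S (mul a b) = mul (S b) (S a) :=
  funext fun M => S_mul_aux _ a b ha hb M rfl

/-- counit -/
noncomputable def eps : Obj F → ℂ := fun M => if M.dim = 0 then 1 else 0

theorem delta_eps {A : Obj F} (h : A.dim ≠ 0) : delta (eps (F := F)) A = 0 := by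
  funext B
  unfold delta eps
  rw [Finset.sum_eq_zero, mul_zero]; rfl
  intro u _
  rw [dim_ext, if_neg]; omega

theorem S_eps : S (eps (F := F)) = eps := by
  funext M
  by_cases h : M.dim = 0
  · rw [S_dim_zero _ h]
  · rw [S_dim_pos _ h, Finset.sum_eq_zero]
    · simp [eps, h]
    · intro N _
      rw [delta_eps (fun h' => N.2 (eq_bot_of_dim h')), S_zero]; rfl

theorem S_cusp {c : Obj F → ℂ} (hc : Inv c) (h0 : ∀ M : Obj F, M.dim = 0 → c M = 0)
    (hd : ∀ A B : Obj F, A.dim ≠ 0 → B.dim ≠ 0 → delta c A B = 0) : S c = (-1 : ℂ) • c := by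
  funext M
  by_cases h : M.dim = 0
  · rw [S_dim_zero _ h]; simp [h0 M h]
  · have e : ∀ A : Obj F, A.dim ≠ 0 → delta c A = c A • eps := by
      intro A hA
      funext B
      by_cases hB : B.dim = 0
      · rw [delta_zero_right hc A hB]; simp [eps, hB]
      · rw [hd A B hA hB]; simp [eps, hB]
    rw [S_dim_pos _ h]
    have htop : M.top ≠ M.bot := by
      intro h'
      have h1 := dim_sub_top M
      rw [h', dim_sub_bot] at h1
      exact h h1.symm
    rw [Finset.sum_eq_single ⟨M.top, htop⟩]
    · have : (M.sub M.top).dim ≠ 0 := by rw [dim_sub_top]; exact h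
      rw [e _ this, S_smul, S_eps, ← hc _ _ (sub_top M)]
      simp [eps, dim_quo_top]
    · intro N _ hN
      have : (M.sub N.1).dim ≠ 0 := fun h' => N.2 (eq_bot_of_dim h')
      rw [e _ this, S_smul, S_eps]
      have h2 : (M.quo N.1).dim ≠ 0 := fun h' => hN (Subtype.ext (eq_top_of_dim h'))
      simp [eps, h2]
    · simp

theorem SS_mul {n : ℕ} (ih : ∀ m < n, ∀ f : Obj F → ℂ, Inv f → ∀ M : Obj F, M.dim = m →
    S (S f) M = f M) {a b : Obj F → ℂ} (ha : Inv a) (hb : Inv b)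
    (ha0 : ∀ M : Obj F, M.dim = 0 → a M = 0) (hb0 : ∀ M : Obj F, M.dim = 0 → b M = 0)
    (M : Obj F) (hM : M.dim = n) : S (S (mul a b)) M = mul a b M := by
  rw [S_mul ha hb, S_mul (S_inv hb) (S_inv ha)]
  have z : ∀ f : Obj F → ℂ, (∀ M : Obj F, M.dim = 0 → f M = 0) → ∀ M : Obj F, M.dim = 0 →
      S (S f) M = 0 := by
    intro f hf M h
    rw [S_dim_zero _ h, S_dim_zero _ h, hf M h]
  unfold mul
  refine Finset.sum_congr rfl fun N _ => ?_
  have hd := dim_sub_add_quo M N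
  by_cases h1 : (M.sub N).dim = 0
  · rw [z a ha0 _ h1, ha0 _ h1, zero_mul, zero_mul]
  by_cases h2 : (M.quo N).dim = 0
  · rw [z b hb0 _ h2, hb0 _ h2, mul_zero, mul_zero]
  rw [ih _ (by omega) a ha _ rfl, ih _ (by omega) b hb _ rfl]

end Obj

end HCAux

namespace HCAux

open scoped Classical

variable {F : Type} [Field F]

namespace Obj

/-- change the endomorphism -/
def wz (M : Obj F) (z : M.V →ₗ[F] M.V) : Obj F := ⟨M.V, z⟩

/-- indicator function of an isomorphism class -/
noncomputable def ind (A : Obj F) : Obj F → ℂ := fun M => if Iso M A then 1 else 0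

theorem ind_inv (A : Obj F) : Inv (ind A) := by
  intro M M' h
  unfold ind
  have : Iso M A ↔ Iso M' A := ⟨fun h' => h.symm.trans h', fun h' => h.trans h'⟩
  simp only [this]

theorem ind_dim {A M : Obj F} (h : ind A M ≠ 0) : Iso M A := by
  unfold ind at h
  by_contra h'
  simp [h'] at h

theorem star_ind (A M : Obj F) : (starRingEnd ℂ) (ind A M) = ind A M := by
  unfold ind
  split_ifs <;> simp

theorem ext_sub (A B : Obj F) (u : B.V →ₗ[F] A.V)
    (h : ∀ v ∈ ((⊤ : Submodule F A.V).prod (⊥ : Submodule F B.V) : Submodule F (ext A B u).V),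
      (ext A B u).z v ∈ ((⊤ : Submodule F A.V).prod (⊥ : Submodule F B.V) : Submodule F (A.V × B.V))) :
    Iso A ((ext A B u).sub ⟨(⊤ : Submodule F A.V).prod (⊥ : Submodule F B.V), h⟩) := by
  refine sub_iso (M := ext A B u) _ (LinearMap.inl F A.V B.V) ?_ ?_ ?_
  · exact LinearMap.inl_injective
  · intro v
    change (A.z v, (0 : B.V)) = (A.z v + u 0, B.z 0)
    simp
  · rintro ⟨x, y⟩
    change (x ∈ (⊤ : Submodule F A.V) ∧ y ∈ (⊥ : Submodule F B.V)) ↔ ∃ v, (v, (0 : B.V)) = (x, y)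
    simp [eq_comm]

theorem ext_quo (A B : Obj F) (u : B.V →ₗ[F] A.V)
    (h : ∀ v ∈ ((⊤ : Submodule F A.V).prod (⊥ : Submodule F B.V) : Submodule F (ext A B u).V),
      (ext A B u).z v ∈ ((⊤ : Submodule F A.V).prod (⊥ : Submodule F B.V) : Submodule F (A.V × B.V))) :
    Iso ((ext A B u).quo ⟨(⊤ : Submodule F A.V).prod (⊥ : Submodule F B.V), h⟩) B := by
  refine quo_iso (M := ext A B u) _ (LinearMap.snd F A.V B.V) ?_ ?_ ?_
  · exact LinearMap.snd_surjective
  · intro v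
    rfl
  · rintro ⟨x, y⟩
    change (x ∈ (⊤ : Submodule F A.V) ∧ y ∈ (⊥ : Submodule F B.V)) ↔ y = 0
    simp

theorem ext_stable (A B : Obj F) (u : B.V →ₗ[F] A.V) :
    ∀ v ∈ ((⊤ : Submodule F A.V).prod (⊥ : Submodule F B.V) : Submodule F (ext A B u).V),
      (ext A B u).z v ∈ ((⊤ : Submodule F A.V).prod (⊥ : Submodule F B.V) : Submodule F (A.V × B.V)) := by
  rw [stable_prod_iff]
  refine ⟨by simp, by simp, fun v _ => ?_⟩
  exact Submodule.mem_top

theorem G_ext {a b : Obj F → ℂ} (ha : Inv a) (hb : Inv b) (A B : Obj F) (u : B.V →ₗ[F] A.V) :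
    G a b (ext A B u) ((⊤ : Submodule F A.V).prod (⊥ : Submodule F B.V)) = a A * b B := by
  refine (G_pos a b (ext A B u) _ (ext_stable A B u)).trans ?_
  rw [ha _ _ (ext_sub A B u (ext_stable A B u)), hb _ _ (ext_quo A B u (ext_stable A B u))]

/-- plain object -/
def EO (A B : Obj F) (w : (A.V × B.V) →ₗ[F] (A.V × B.V)) : Obj F := ⟨A.V × B.V, w⟩

/-- the block upper triangular endomorphisms -/
def tri (A B : Obj F) (p : (A.V →ₗ[F] A.V) × (B.V →ₗ[F] B.V) × (B.V →ₗ[F] A.V)) :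
    (A.V × B.V) →ₗ[F] (A.V × B.V) := (ext (A.wz p.1) (B.wz p.2.1) p.2.2).z

theorem tri_apply (A B : Obj F) (p : (A.V →ₗ[F] A.V) × (B.V →ₗ[F] B.V) × (B.V →ₗ[F] A.V))
    (x : A.V) (y : B.V) : tri A B p (x, y) = (p.1 x + p.2.2 y, p.2.1 y) := rfl

theorem tri_inj (A B : Obj F) : Function.Injective (tri A B) := by
  rintro ⟨x, y, u⟩ ⟨x', y', u'⟩ h
  have h' : ∀ a b, (x a + u b, y b) = (x' a + u' b, y' b) := fun a b =>
    LinearMap.congr_fun h (a, b)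
  refine Prod.ext (LinearMap.ext fun a => ?_) (Prod.ext (LinearMap.ext fun b => ?_)
    (LinearMap.ext fun b => ?_))
  · simpa using congrArg Prod.fst (h' a 0)
  · simpa using congrArg Prod.snd (h' 0 b)
  · simpa using congrArg Prod.fst (h' 0 b)

theorem exists_tri (A B : Obj F) (w : (A.V × B.V) →ₗ[F] (A.V × B.V))
    (h : ∀ v ∈ (⊤ : Submodule F A.V).prod (⊥ : Submodule F B.V),
      w v ∈ (⊤ : Submodule F A.V).prod (⊥ : Submodule F B.V)) : ∃ p, tri A B p = w := by
  refine ⟨⟨LinearMap.fst F _ _ ∘ₗ w ∘ₗ LinearMap.inl F _ _, LinearMap.snd F _ _ ∘ₗ w ∘ₗ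
    LinearMap.inr F _ _, LinearMap.fst F _ _ ∘ₗ w ∘ₗ LinearMap.inr F _ _⟩, ?_⟩
  refine LinearMap.ext ?_
  rintro ⟨x, y⟩
  have h1 : (w (x, 0)).2 = 0 := by
    have := h (x, 0) ⟨Submodule.mem_top, Submodule.zero_mem _⟩
    exact (Submodule.mem_bot F).1 this.2
  have h2 : w (x, y) = w (x, 0) + w (0, y) := by rw [← map_add]; simp
  rw [tri_apply, h2]
  refine Prod.ext ?_ ?_
  · rfl
  · change (w (0, y)).2 = (w (x, 0)).2 + (w (0, y)).2
    rw [h1, zero_add]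

theorem Q0_eq {c : Obj F → ℂ} (hc : Inv c) (A B : Obj F) :
    ∑ w, c (EO A B w) * G (ind A) (ind B) (EO A B w) ((⊤ : Submodule F A.V).prod (⊥ : Submodule F B.V))
    = (∑ x, ind A (A.wz x)) * (∑ y, ind B (B.wz y)) *
      ((Fintype.card (B.V →ₗ[F] A.V) : ℂ) * delta c A B) := by
  have key : ∑ p, c (EO A B (tri A B p)) * G (ind A) (ind B) (EO A B (tri A B p))
      ((⊤ : Submodule F A.V).prod (⊥ : Submodule F B.V)) =
      ∑ w, c (EO A B w) * G (ind A) (ind B) (EO A B w)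
        ((⊤ : Submodule F A.V).prod (⊥ : Submodule F B.V)) := by
    refine Fintype.sum_of_injective (tri A B) (tri_inj A B) _ _ ?_ (fun _ => rfl)
    intro w hw
    refine mul_eq_zero_of_right _ (G_neg _ _ (EO A B w) _ fun h => hw (exists_tri A B w h))
  rw [← key, Fintype.sum_prod_type, Finset.sum_mul_sum, Finset.sum_mul]
  refine Finset.sum_congr rfl fun x _ => ?_
  rw [Fintype.sum_prod_type, Finset.sum_mul]
  refine Finset.sum_congr rfl fun y _ => ?_
  have : ∀ u, c (EO A B (tri A B (x, y, u))) * G (ind A) (ind B) (EO A B (tri A B (x, y, u)))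
      ((⊤ : Submodule F A.V).prod (⊥ : Submodule F B.V)) =
      c (ext (A.wz x) (B.wz y) u) * (ind A (A.wz x) * ind B (B.wz y)) := by
    intro u
    exact congrArg _ (G_ext (ind_inv A) (ind_inv B) (A.wz x) (B.wz y) u)
  rw [Finset.sum_congr rfl fun u _ => this u, ← Finset.sum_mul]
  by_cases h1 : Iso (A.wz x) A
  · by_cases h2 : Iso (B.wz y) B
    · have hd := delta_iso hc h1 h2
      rw [← hd, mul_comm]
      congr 1
      unfold delta
      change _ = (Fintype.card (B.V →ₗ[F] A.V) : ℂ) * ((Fintype.card (B.V →ₗ[F] A.V) : ℂ)⁻¹ * _)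
      rw [mul_inv_cancel_left₀]
      · rfl
      · exact_mod_cast Fintype.card_ne_zero
    · have : ind B (B.wz y) = 0 := if_neg h2
      rw [this]; simp
  · have : ind A (A.wz x) = 0 := if_neg h1
    rw [this]; simp

theorem sum_ind_ne (A : Obj F) : (∑ x, ind A (A.wz x)) ≠ 0 := by
  unfold ind
  rw [Finset.sum_boole]
  have : (Finset.univ.filter fun x => Iso (A.wz x) A).card ≠ 0 := by
    rw [Finset.card_ne_zero]
    exact ⟨A.z, Finset.mem_filter.2 ⟨Finset.mem_univ _, Iso.refl A⟩⟩
  exact_mod_cast this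

theorem QN_eq {c : Obj F → ℂ} (hc : Inv c) (A B M : Obj F) (hd : A.dim + B.dim = M.dim)
    (N : Submodule F M.V) (hN : Module.finrank F N = A.dim) :
    ∑ z, c (M.wz z) * G (ind A) (ind B) (M.wz z) N =
    ∑ w, c (EO A B w) * G (ind A) (ind B) (EO A B w)
      ((⊤ : Submodule F A.V).prod (⊥ : Submodule F B.V)) := by
  obtain ⟨C, hC⟩ := Submodule.exists_isCompl N
  have hfC : Module.finrank F C = B.dim := by
    have := Submodule.finrank_add_eq_of_isCompl hC
    unfold dim at *
    omega
  let e1 : A.V ≃ₗ[F] N := LinearEquiv.ofFinrankEq _ _ hN.symm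
  let e2 : B.V ≃ₗ[F] C := LinearEquiv.ofFinrankEq _ _ hfC.symm
  let e : (A.V × B.V) ≃ₗ[F] M.V := (e1.prodCongr e2).trans (Submodule.prodEquivOfIsCompl N C hC)
  have he : ∀ x y, e (x, y) = (e1 x : M.V) + (e2 y : M.V) := fun x y => rfl
  have hmap : ((⊤ : Submodule F A.V).prod (⊥ : Submodule F B.V)).map
      (e : (A.V × B.V) →ₗ[F] M.V) = N := by
    ext m
    constructor
    · rintro ⟨⟨x, y⟩, ⟨-, hy⟩, rfl⟩
      have hy' : y = 0 := (Submodule.mem_bot F).1 hy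
      subst hy'
      change e (x, 0) ∈ N
      rw [he]; simp
    · intro hm
      refine ⟨(e1.symm ⟨m, hm⟩, 0), ⟨Submodule.mem_top, Submodule.zero_mem _⟩, ?_⟩
      change e _ = m
      rw [he]; simp
  symm
  refine Fintype.sum_equiv e.conj.toEquiv _ _ ?_
  intro w
  have hz : ∀ v, e ((EO A B w).z v) = (M.wz (e.conj w)).z (e v) := by
    intro v
    change e (w v) = e.conj w (e v)
    have h5 : e.symm (e v) = v := e.symm_apply_apply v
    change e (w v) = e (w (e.symm (e v)))
    rw [h5]
  have h1 : c (EO A B w) = c (M.wz (e.conj w)) := hc _ _ ⟨e, hz⟩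
  have h2 := G_iso (M := EO A B w) (M' := M.wz (e.conj w)) (ind_inv A) (ind_inv B) e hz
    ((⊤ : Submodule F A.V).prod (⊥ : Submodule F B.V))
  rw [h1]
  refine congrArg _ (h2.trans ?_)
  exact congrArg (G (ind A) (ind B) (M.wz (e.conj w))) hmap

theorem cusp_of_orth {c : Obj F → ℂ} (hc : Inv c) (A B M : Obj F) (hd : A.dim + B.dim = M.dim)
    (h : ∑ z, c (M.wz z) * mul (ind A) (ind B) (M.wz z) = 0) : delta c A B = 0 := by
  set Q := ∑ w, c (EO A B w) * G (ind A) (ind B) (EO A B w)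
      ((⊤ : Submodule F A.V).prod (⊥ : Submodule F B.V)) with hQ
  have h1 : ∑ z, c (M.wz z) * mul (ind A) (ind B) (M.wz z) =
      ∑ N : Submodule F M.V, if Module.finrank F N = A.dim then Q else 0 := by
    have : ∀ z, c (M.wz z) * mul (ind A) (ind B) (M.wz z) =
        ∑ N : Submodule F M.V, c (M.wz z) * G (ind A) (ind B) (M.wz z) N := by
      intro z
      rw [mul_eq_G]
      exact Finset.mul_sum _ _ _
    rw [Finset.sum_congr rfl fun z _ => this z, Finset.sum_comm]
    refine Finset.sum_congr rfl fun N _ => ?_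
    split_ifs with hN
    · exact QN_eq hc A B M hd N hN
    · refine Finset.sum_eq_zero fun z _ => mul_eq_zero_of_right _ ?_
      by_contra h0
      by_cases hs : ∀ v ∈ N, z v ∈ N
      · apply hN
        have h0' : ind A ((M.wz z).sub ⟨N, hs⟩) * ind B ((M.wz z).quo ⟨N, hs⟩) ≠ 0 := by
          intro h00
          exact h0 ((G_pos (ind A) (ind B) (M.wz z) N hs).trans h00)
        exact (ind_dim (left_ne_zero_of_mul h0')).dim_eq
      · exact h0 (G_neg _ _ (M.wz z) N hs)
  rw [h, ← Finset.sum_filter, Finset.sum_const, nsmul_eq_mul] at h1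
  have hcard : (Finset.univ.filter fun N : Submodule F M.V => Module.finrank F N = A.dim).card ≠ 0 := by
    rw [Finset.card_ne_zero]
    have hfr : Module.finrank F (A.V × B.V) = Module.finrank F M.V := by
      rw [Module.finrank_prod]; exact hd
    let e : (A.V × B.V) ≃ₗ[F] M.V := LinearEquiv.ofFinrankEq _ _ hfr
    refine ⟨LinearMap.range ((e : (A.V × B.V) →ₗ[F] M.V) ∘ₗ LinearMap.inl F A.V B.V),
      Finset.mem_filter.2 ⟨Finset.mem_univ _, ?_⟩⟩
    exact LinearMap.finrank_range_of_inj (e.injective.comp LinearMap.inl_injective)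
  have hQ0 : Q = 0 := by
    rcases mul_eq_zero.1 h1.symm with h2 | h2
    · exact absurd (by exact_mod_cast h2) hcard
    · exact h2
  rw [hQ, Q0_eq hc] at hQ0
  have h3 := (mul_eq_zero.1 hQ0).resolve_left (mul_ne_zero (sum_ind_ne A) (sum_ind_ne B))
  refine (mul_eq_zero.1 h3).resolve_left ?_
  exact_mod_cast Fintype.card_ne_zero

theorem wz_iso {M M' : Obj F} (h : Iso M M') : ∀ z, ∃ z', Iso (M.wz z) (M'.wz z') := by
  obtain ⟨e, -⟩ := h
  intro z
  refine ⟨e.conj z, e, fun v => ?_⟩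
  have h5 : e.symm (e v) = v := e.symm_apply_apply v
  change e (z v) = e (z (e.symm (e v)))
  rw [h5]

theorem iso_wz {M M' : Obj F} (h : M.dim = M'.dim) : ∃ z', Iso M (M'.wz z') := by
  let e : M.V ≃ₗ[F] M'.V := LinearEquiv.ofFinrankEq _ _ h
  refine ⟨e.conj M.z, e, fun v => ?_⟩
  have h5 : e.symm (e v) = v := e.symm_apply_apply v
  change e (M.z v) = e (M.z (e.symm (e v)))
  rw [h5]

theorem star_mul_ind (A B M : Obj F) :
    (starRingEnd ℂ) (mul (ind A) (ind B) M) = mul (ind A) (ind B) M := by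
  unfold mul
  rw [map_sum]
  refine Finset.sum_congr rfl fun N _ => ?_
  rw [map_mul, star_ind, star_ind]

theorem SS (n : ℕ) : ∀ f : Obj F → ℂ, Inv f → ∀ M : Obj F, M.dim = n → S (S f) M = f M := by
  induction n using Nat.strong_induction_on with
  | _ n ih =>
  intro f hf M hM
  rcases Nat.eq_zero_or_pos n with hn | hn
  · rw [S_dim_zero _ (hM.trans hn), S_dim_zero _ (hM.trans hn)]
  let X := EuclideanSpace ℂ (M.V →ₗ[F] M.V)
  let gen : Set X := {v | ∃ a b : Obj F → ℂ, Inv a ∧ Inv b ∧ (∀ M, M.dim = 0 → a M = 0) ∧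
    (∀ M, M.dim = 0 → b M = 0) ∧ v = WithLp.toLp 2 fun z => mul a b (M.wz z)}
  let U : Submodule ℂ X := Submodule.span ℂ gen
  obtain ⟨u, hu, c, hc, huc⟩ := U.exists_add_mem_mem_orthogonal
    (WithLp.toLp 2 fun z => f (M.wz z) : X)
  have hP : ∃ g : Obj F → ℂ, Inv g ∧ (∀ z, g (M.wz z) = u z) ∧
      ∀ M' : Obj F, M'.dim = n → S (S g) M' = g M' := by
    clear huc hc
    induction hu using Submodule.span_induction with
    | mem x hx =>
      obtain ⟨a, b, ha, hb, ha0, hb0, rfl⟩ := hx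
      refine ⟨mul a b, mul_inv ha hb, fun z => rfl, fun M' hM' => ?_⟩
      exact SS_mul ih ha hb ha0 hb0 M' hM'
    | zero => exact ⟨0, fun _ _ _ => rfl, fun z => rfl, fun M' _ => by rw [S_zero, S_zero]⟩
    | add x y _ _ hx hy =>
      obtain ⟨g, hg, h1, h2⟩ := hx
      obtain ⟨g', hg', h1', h2'⟩ := hy
      refine ⟨g + g', fun A B h => ?_, fun z => ?_, fun M' hM' => ?_⟩
      · rw [Pi.add_apply, Pi.add_apply, hg _ _ h, hg' _ _ h]
      · rw [Pi.add_apply, h1, h1']; rfl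
      · rw [S_add, S_add, Pi.add_apply, Pi.add_apply, h2 _ hM', h2' _ hM']
    | smul t x _ hx =>
      obtain ⟨g, hg, h1, h2⟩ := hx
      refine ⟨t • g, fun A B h => ?_, fun z => ?_, fun M' hM' => ?_⟩
      · rw [Pi.smul_apply, Pi.smul_apply, hg _ _ h]
      · rw [Pi.smul_apply, h1]; rfl
      · rw [S_smul, S_smul, Pi.smul_apply, Pi.smul_apply, h2 _ hM']
  obtain ⟨g, hg, hgu, hgS⟩ := hP
  let ch : Obj F → ℂ := fun M' => if M'.dim = n then f M' - g M' else 0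
  have hch : Inv ch := by
    intro A B h
    simp only [ch, h.dim_eq, hf _ _ h, hg _ _ h]
  have hchz : ∀ z, ch (M.wz z) = c z := by
    intro z
    have h1 : (M.wz z).dim = n := hM
    have h2 : f (M.wz z) = u z + c z := congrArg (fun v : X => v z) huc
    change (if (M.wz z).dim = n then f (M.wz z) - g (M.wz z) else 0) = c z
    rw [if_pos h1, h2, hgu]; ring
  have hcusp : ∀ A B : Obj F, A.dim ≠ 0 → B.dim ≠ 0 → delta ch A B = 0 := by
    intro A B hA hB
    by_cases hd : A.dim + B.dim = n
    · refine cusp_of_orth hch A B M (hd.trans hM.symm) ?_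
      have hmem : (WithLp.toLp 2 fun z => mul (ind A) (ind B) (M.wz z) : X) ∈ U := by
        refine Submodule.subset_span ⟨ind A, ind B, ind_inv A, ind_inv B, ?_, ?_, rfl⟩
        · intro M' h0
          by_contra h
          exact hA ((ind_dim h).dim_eq.symm.trans h0)
        · intro M' h0
          by_contra h
          exact hB ((ind_dim h).dim_eq.symm.trans h0)
      have := (Submodule.mem_orthogonal U c).1 hc _ hmem
      rw [PiLp.inner_apply] at this
      refine Eq.trans (Finset.sum_congr rfl fun z _ => ?_) this
      rw [hchz, RCLike.inner_apply]
      change _ = c z * (starRingEnd ℂ) (mul (ind A) (ind B) (M.wz z))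
      rw [star_mul_ind]
    · unfold delta
      refine mul_eq_zero_of_right _ (Finset.sum_eq_zero fun u _ => if_neg ?_)
      rw [dim_ext]; exact hd
  have hch0 : ∀ M' : Obj F, M'.dim = 0 → ch M' = 0 := fun M' h => if_neg (by omega)
  have hSc : S (S ch) = ch := by
    rw [S_cusp hch hch0 hcusp, S_smul, S_cusp hch hch0 hcusp, smul_smul]
    simp
  have hfg : ∀ M' : Obj F, M'.dim = n → f M' = (g + ch) M' := by
    intro M' h
    change f M' = g M' + (if M'.dim = n then f M' - g M' else 0)
    rw [if_pos h]; ring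
  have h1 : S (S f) M = S (S (g + ch)) M :=
    S_congr_dim n _ _ (fun M' h => S_congr_dim n _ _ hfg M' h) M hM
  rw [h1, S_add, S_add, hSc, Pi.add_apply, hgS M hM, ← Pi.add_apply, ← hfg M hM]

theorem SS_eq {f : Obj F → ℂ} (hf : Inv f) : S (S f) = f := funext fun M => SS _ f hf M rfl

end Obj
end HCAux

namespace HCAux

open scoped Classical
open Matrix

variable {F : Type} [Field F]

namespace Obj

/-- iterated induction-restriction -/
noncomputable def RL : List ℕ → (Obj F → ℂ) → Obj F → ℂ
  | [], a => a
  | (k :: L), a => fun M => ∑ N : M.St, if (M.sub N).dim = k then RL L (delta a (M.sub N)) (M.quo N) else 0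

theorem RL_inv (L : List ℕ) : ∀ a : Obj F → ℂ, Inv a → Inv (RL L a) := by
  induction L with
  | nil => intro a ha; exact ha
  | cons k L ih =>
    intro a ha M M' h
    refine sum_iso (Φ := fun A B => if A.dim = k then RL L (delta a A) B else 0) ?_ ?_ h
    · intro A A' B hA
      simp only [hA.dim_eq, delta_congr_left ha hA]
    · intro A B B' hB
      simp only [ih _ (delta_inv ha A) _ _ hB]

theorem sum_comp (n : ℕ) (hn : 0 < n) (φ : List ℕ → ℂ) :
    ∑ c : Composition n, φ c.blocks =
    ∑ k : Fin n, ∑ c : Composition (n - (k + 1)), φ ((k + 1) :: c.blocks) := by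
  rw [← Fintype.sum_sigma' (fun (k : Fin n) (c : Composition (n - (k + 1))) => φ ((k + 1) :: c.blocks))]
  symm
  refine Fintype.sum_bijective (fun p : (Σ k : Fin n, Composition (n - (k + 1))) =>
    (⟨(p.1 + 1) :: p.2.blocks, by
      intro i hi
      rcases List.mem_cons.1 hi with h | h
      · omega
      · exact p.2.blocks_pos h, by
      have := p.2.blocks_sum
      have := p.1.2
      rw [List.sum_cons]; omega⟩ : Composition n)) ⟨?_, ?_⟩ _ _ ?_
  · rintro ⟨k, c⟩ ⟨k', c'⟩ h
    have h' : ((k : ℕ) + 1) :: c.blocks = ((k' : ℕ) + 1) :: c'.blocks := congrArg Composition.blocks h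
    rw [List.cons.injEq] at h'
    have hk : k = k' := Fin.ext (by omega)
    subst hk
    have : c = c' := Composition.ext h'.2
    rw [this]
  · rintro ⟨bl, hp, hs⟩
    cases bl with
    | nil => simp at hs; omega
    | cons k L =>
      have hk : 0 < k := hp (by simp)
      rw [List.sum_cons] at hs
      refine ⟨⟨⟨k - 1, by omega⟩, ⟨L, fun hi => hp (List.mem_cons_of_mem _ hi), ?_⟩⟩, ?_⟩
      · change L.sum = n - (k - 1 + 1); omega
      · refine Composition.ext ?_
        change (k - 1 + 1) :: L = k :: L
        rw [Nat.sub_add_cancel hk]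
  · intro p
    rfl

theorem T_eq (n : ℕ) : ∀ (f : Obj F → ℂ) (M : Obj F), M.dim = n →
    ∑ c : Composition n, (-1 : ℂ) ^ c.blocks.length * RL c.blocks f M = S f M := by
  induction n using Nat.strong_induction_on with
  | _ n ih =>
  intro f M hM
  rcases Nat.eq_zero_or_pos n with hn | hn
  · subst hn
    have hbl : ∀ c : Composition 0, c.blocks = [] := by
      intro c
      have h := c.blocks_sum
      rcases hb : c.blocks with _ | ⟨k, L⟩
      · rfl
      · have := c.blocks_pos (i := k) (by rw [hb]; simp)
        rw [hb, List.sum_cons] at h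
        omega
    have hsub : Subsingleton (Composition 0) :=
      ⟨fun c c' => Composition.ext ((hbl c).trans (hbl c').symm)⟩
    rw [S_dim_zero _ hM, Fintype.sum_subsingleton _ (default : Composition 0), hbl]
    simp [RL]
  · rw [S_dim_pos f (by omega)]
    rw [sum_comp n hn (fun L => (-1 : ℂ) ^ L.length * RL L f M)]
    have h1 : ∀ k : Fin n, ∑ c : Composition (n - (k + 1)),
        (-1 : ℂ) ^ (((k : ℕ) + 1) :: c.blocks).length * RL ((k + 1) :: c.blocks) f M =
        ∑ N : M.St, if (M.sub N).dim = k + 1 then - S (delta f (M.sub N)) (M.quo N) else 0 := by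
      intro k
      have : ∀ c : Composition (n - (k + 1)),
        (-1 : ℂ) ^ (((k : ℕ) + 1) :: c.blocks).length * RL ((k + 1) :: c.blocks) f M =
        ∑ N : M.St, if (M.sub N).dim = k + 1 then
          - ((-1 : ℂ) ^ c.blocks.length * RL c.blocks (delta f (M.sub N)) (M.quo N)) else 0 := by
        intro c
        rw [RL, Finset.mul_sum]
        refine Finset.sum_congr rfl fun N _ => ?_
        split_ifs
        · rw [List.length_cons, pow_succ]; ring
        · simp
      rw [Finset.sum_congr rfl fun c _ => this c, Finset.sum_comm]
      refine Finset.sum_congr rfl fun N _ => ?_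
      split_ifs with h
      · rw [Finset.sum_neg_distrib, ih (n - (k + 1)) (by omega)]
        have := dim_sub_add_quo M N
        omega
      · simp
    rw [Finset.sum_congr rfl fun k _ => h1 k, Finset.sum_comm, ← Finset.sum_neg_distrib]
    symm
    refine Fintype.sum_of_injective Subtype.val Subtype.val_injective _ _ ?_ ?_
    · intro N hN
      have hN' : N = M.bot := by
        by_contra h
        exact hN ⟨⟨N, h⟩, rfl⟩
      refine Finset.sum_eq_zero fun k _ => if_neg ?_
      rw [hN', dim_sub_bot]; omega
    · rintro ⟨N, hN⟩
      have h0 : (M.sub N).dim ≠ 0 := fun h => hN (eq_bot_of_dim h)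
      have := dim_sub_add_quo M N
      rw [Finset.sum_eq_single (⟨(M.sub N).dim - 1, by omega⟩ : Fin n)]
      · rw [if_pos]
        change (M.sub N).dim = (M.sub N).dim - 1 + 1
        omega
      · intro k _ hk
        refine if_neg fun h => hk (Fin.ext ?_)
        change (M.sub N).dim = (k : ℕ) + 1 at h
        change (k : ℕ) = (M.sub N).dim - 1
        omega
      · simp

/-- summand extended by zero -/
noncomputable def H (h : Obj F → Obj F → ℂ) (M : Obj F) (N : Submodule F M.V) : ℂ :=
  if hs : ∀ v ∈ N, M.z v ∈ N then h (M.sub ⟨N, hs⟩) (M.quo ⟨N, hs⟩) else 0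

theorem H_iso {h : Obj F → Obj F → ℂ} (ha : ∀ A A' B, Iso A A' → h A B = h A' B)
    (hb : ∀ A B B', Iso B B' → h A B = h A B') {M M' : Obj F} (e : M.V ≃ₗ[F] M'.V)
    (he : ∀ v, e (M.z v) = M'.z (e v)) (N : Submodule F M.V) :
    H h M N = H h M' (N.map (e : M.V →ₗ[F] M'.V)) := by
  by_cases hs : ∀ v ∈ N, M.z v ∈ N
  · have h' := (stEquiv e he ⟨N, hs⟩).2
    refine (dif_pos hs).trans (Eq.trans ?_ (dif_pos h').symm)
    rw [ha _ _ _ (sub_stEquiv e he ⟨N, hs⟩), hb _ _ _ (quo_stEquiv e he ⟨N, hs⟩)]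
    rfl
  · have hs' : ¬ ∀ v ∈ N.map (e : M.V →ₗ[F] M'.V), M'.z v ∈ N.map (e : M.V →ₗ[F] M'.V) := by
      intro h'
      apply hs
      intro v hv
      obtain ⟨w, hw, hw'⟩ := h' (e v) ⟨v, hv, rfl⟩
      have : w = M.z v := e.injective (hw'.trans (he v).symm)
      exact this ▸ hw
    exact Eq.trans (b := (0 : ℂ)) (dif_neg hs) (Eq.symm (show H h M' _ = 0 from dif_neg hs'))

theorem H_ext {h : Obj F → Obj F → ℂ} (ha : ∀ A A' B, Iso A A' → h A B = h A' B)
    (hb : ∀ A B B', Iso B B' → h A B = h A B') (A B : Obj F) (u : B.V →ₗ[F] A.V) :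
    H h (ext A B u) ((⊤ : Submodule F A.V).prod (⊥ : Submodule F B.V)) = h A B := by
  refine (dif_pos (ext_stable A B u)).trans ?_
  rw [ha _ _ _ (ext_sub A B u (ext_stable A B u)), hb _ _ _ (ext_quo A B u (ext_stable A B u))]

variable [Fintype F] [DecidableEq F]

open HCPaper

/-- object of a matrix -/
noncomputable def O {n : ℕ} (x : gl F n) : Obj F := ⟨Fin n → F, Matrix.toLin' x⟩

theorem dim_O {n : ℕ} (x : gl F n) : (O x).dim = n := Module.finrank_fin_fun F

/-- linear equivalence of an invertible matrix -/
noncomputable def ge {n : ℕ} (g : GL (Fin n) F) : (Fin n → F) ≃ₗ[F] (Fin n → F) :=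
  LinearEquiv.ofLinearMap (Matrix.toLin' (g : Matrix (Fin n) (Fin n) F))
    (Matrix.toLin' ((g⁻¹ : GL (Fin n) F) : Matrix (Fin n) (Fin n) F))
    (by rw [← Matrix.toLin'_mul, ← Units.val_mul]; simp)
    (by rw [← Matrix.toLin'_mul, ← Units.val_mul]; simp)

theorem ge_apply {n : ℕ} (g : GL (Fin n) F) (v : Fin n → F) :
    ge g v = (g : Matrix (Fin n) (Fin n) F) *ᵥ v := rfl

theorem ge_z {n : ℕ} (g : GL (Fin n) F) (x : gl F n) (v : Fin n → F) :
    ge g ((O x).z v) = (O (conjM g x)).z (ge g v) := by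
  change (g : Matrix (Fin n) (Fin n) F) *ᵥ (x *ᵥ v) =
    (conjM g x) *ᵥ ((g : Matrix (Fin n) (Fin n) F) *ᵥ v)
  unfold conjM
  rw [Matrix.mulVec_mulVec, Matrix.mulVec_mulVec, Matrix.mul_assoc _ _ (g : Matrix (Fin n) (Fin n) F),
    ← Units.val_mul]
  simp

theorem exists_ge {n : ℕ} (e : (Fin n → F) ≃ₗ[F] (Fin n → F)) : ∃ g : GL (Fin n) F, ge g = e := by
  refine ⟨⟨LinearMap.toMatrix' (e : (Fin n → F) →ₗ[F] (Fin n → F)),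
    LinearMap.toMatrix' (e.symm : (Fin n → F) →ₗ[F] (Fin n → F)), ?_, ?_⟩, ?_⟩
  · rw [← LinearMap.toMatrix'_comp]; simp
  · rw [← LinearMap.toMatrix'_comp]; simp
  · ext1 v
    rw [ge_apply]
    change LinearMap.toMatrix' (e : (Fin n → F) →ₗ[F] (Fin n → F)) *ᵥ v = e v
    rw [← Matrix.toLin'_apply, Matrix.toLin'_toMatrix']
    rfl

theorem iso_conj {n : ℕ} (x x' : gl F n) (h : Iso (O x) (O x')) : ∃ g, x' = conjM g x := by
  obtain ⟨e, he⟩ := h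
  obtain ⟨g, hg⟩ := exists_ge (F := F) (n := n) e
  refine ⟨g, ?_⟩
  apply Matrix.toLin'.injective
  refine LinearMap.ext fun v => ?_
  obtain ⟨w, rfl⟩ := (ge g).surjective v
  have h1 := ge_z g x w
  have h2 : ge g ((O x).z w) = (O x').z (ge g w) := by rw [hg]; exact he w
  exact h2.symm.trans h1

/-- extension of an invariant function to all objects -/
noncomputable def hat {n : ℕ} (f : gl F n → ℂ) : Obj F → ℂ := fun M =>
  if h : ∃ x, Iso M (O x) then f h.choose else 0

theorem hat_O {n : ℕ} {f : gl F n → ℂ} (hf : Invariant n f) (x : gl F n) : hat f (O x) = f x := by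
  have h : ∃ x', Iso (O x) (O x') := ⟨x, Iso.refl _⟩
  refine (dif_pos h).trans ?_
  obtain ⟨g, hg⟩ := iso_conj _ _ h.choose_spec
  rw [hg, hf]

theorem hat_inv {n : ℕ} {f : gl F n → ℂ} (hf : Invariant n f) : Inv (hat f) := by
  intro M M' h
  by_cases h1 : ∃ x : gl F n, Iso M (O x)
  · obtain ⟨x, hx⟩ := h1
    have aux : ∀ M : Obj F, Iso M (O x) → hat f M = f x := by
      intro M hx
      have h1 : ∃ x : gl F n, Iso M (O x) := ⟨x, hx⟩
      refine (dif_pos h1).trans ?_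
      obtain ⟨g, hg⟩ := iso_conj _ _ (hx.symm.trans h1.choose_spec)
      rw [hg, hf]
    rw [aux M hx, aux M' (h.symm.trans hx)]
  · have h2 : ¬ ∃ x : gl F n, Iso M' (O x) := fun ⟨x, hx⟩ => h1 ⟨x, h.trans hx⟩
    exact Eq.trans (b := (0 : ℂ)) (dif_neg h1) (Eq.symm (show hat f M' = 0 from dif_neg h2))

theorem O_cast {m n : ℕ} (h : m = n) (x : gl F m) : O (castM h x) = O x := by
  subst h
  rfl

theorem castFun_O {m n : ℕ} (h : m = n) (g : Obj F → ℂ) :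
    castFun h (fun x => g (O x)) = fun x => g (O x) := by
  subst h
  rfl

/-- splitting of coordinates -/
noncomputable def sg (F : Type) [Field F] (k l : ℕ) :
    ((Fin k → F) × (Fin l → F)) ≃ₗ[F] (Fin (k + l) → F) :=
  (LinearEquiv.sumArrowLequivProdArrow (Fin k) (Fin l) F F).symm.trans
    (LinearEquiv.funCongrLeft F F finSumFinEquiv.symm)

theorem act (k l : ℕ) (m : gl F (k + l)) (a : Fin k → F) (b : Fin l → F) :
    m *ᵥ (sg F k l (a, b)) = sg F k l
      (toBlocks₁₁ (blk k l m) *ᵥ a + toBlocks₁₂ (blk k l m) *ᵥ b,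
       toBlocks₂₁ (blk k l m) *ᵥ a + toBlocks₂₂ (blk k l m) *ᵥ b) := by
  have hs : ∀ (a : Fin k → F) (b : Fin l → F), sg F k l (a, b) = Sum.elim a b ∘ finSumFinEquiv.symm :=
    fun a b => by
      ext i
      obtain ⟨j, rfl⟩ := finSumFinEquiv.surjective i
      rcases j with j | j <;> simp [sg, LinearEquiv.funCongrLeft, LinearEquiv.sumArrowLequivProdArrow, Equiv.sumArrowEquivProdArrow]
  have hfb := Matrix.fromBlocks_mulVec (toBlocks₁₁ (blk k l m)) (toBlocks₁₂ (blk k l m))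
    (toBlocks₂₁ (blk k l m)) (toBlocks₂₂ (blk k l m)) (Sum.elim a b)
  rw [Sum.elim_comp_inl, Sum.elim_comp_inr] at hfb
  rw [hs, hs, ← hfb, Matrix.fromBlocks_toBlocks]
  ext i
  obtain ⟨j, rfl⟩ := finSumFinEquiv.surjective i
  simp only [blk, Function.comp_apply, Equiv.symm_apply_apply, Matrix.mulVec, dotProduct]
  rw [← finSumFinEquiv.sum_comp]
  simp

end Obj
end HCAux

namespace HCAux

open scoped Classical
open Matrix

variable {F : Type} [Field F]

namespace Obj

open HCPaper

variable [Fintype F] [DecidableEq F]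

theorem blk_but (k l : ℕ) (x : gl F k) (u : Matrix (Fin k) (Fin l) F) (y : gl F l) :
    blk k l (but k l x u y) = Matrix.fromBlocks x u 0 y := by
  unfold blk but
  simp

theorem iso_tri (k l : ℕ) (m : gl F (k + l)) (hm : IsBUT k l m) (p : (Fin k → F) × (Fin l → F)) :
    sg F k l ((ext (O (proj k l m).1) (O (proj k l m).2)
      (Matrix.toLin' (toBlocks₁₂ (blk k l m)))).z p) = (O m).z (sg F k l p) := by
  obtain ⟨a, b⟩ := p
  have h := act k l m a b
  unfold IsBUT at hm
  rw [hm, Matrix.zero_mulVec, zero_add] at h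
  exact h.symm

theorem iso_but (k l : ℕ) (x : gl F k) (u : Matrix (Fin k) (Fin l) F) (y : gl F l) :
    Iso (ext (O x) (O y) (Matrix.toLin' u)) (O (but k l x u y)) := by
  refine ⟨sg F k l, fun p => ?_⟩
  have hb : IsBUT k l (but k l x u y) := by
    unfold IsBUT; rw [blk_but]; rfl
  have := iso_tri k l (but k l x u y) hb p
  unfold proj at this
  rw [blk_but] at this
  exact this

theorem HCres_eq {g : Obj F → ℂ} (hg : Inv g) (k l : ℕ) (x : gl F k) (y : gl F l) :
    HCres k l (fun x => g (O x)) (x, y) = delta g (O x) (O y) := by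
  unfold HCres
  split_ifs with hk hl
  · change g (O (castM _ y)) = _
    rw [O_cast, delta_zero_left hg ((dim_O x).trans hk)]
  · change g (O (castM _ x)) = _
    rw [O_cast, delta_zero_right hg _ ((dim_O y).trans hl)]
  · unfold delta
    have hc : (Fintype.card ((O y).V →ₗ[F] (O x).V)) = Fintype.card F ^ (k * l) := by
      have h1 : Fintype.card ((O y).V →ₗ[F] (O x).V) = Fintype.card (Matrix (Fin k) (Fin l) F) :=
        Fintype.card_congr (Matrix.toLin' (R := F) (m := Fin k) (n := Fin l)).symm.toEquiv
      rw [h1]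
      change Fintype.card (Fin k → Fin l → F) = _
      simp [pow_mul']
    rw [hc]
    push_cast
    congr 1
    refine Fintype.sum_equiv (Matrix.toLin' (R := F) (m := Fin k) (n := Fin l)).toEquiv _ _ ?_
    intro u
    exact (hg _ _ (iso_but k l x u y)).symm

/-- the standard subspace -/
noncomputable def Ek (F : Type) [Field F] (k l : ℕ) : Submodule F (Fin (k + l) → F) :=
  ((⊤ : Submodule F (Fin k → F)).prod (⊥ : Submodule F (Fin l → F))).map
    (sg F k l : ((Fin k → F) × (Fin l → F)) →ₗ[F] (Fin (k + l) → F))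

theorem mem_Ek (k l : ℕ) (a : Fin k → F) (b : Fin l → F) : sg F k l (a, b) ∈ Ek F k l ↔ b = 0 := by
  constructor
  · rintro ⟨⟨x, y⟩, ⟨-, hy⟩, h⟩
    have h' : (x, y) = (a, b) := (sg F k l).injective h
    have := (Submodule.mem_bot F).1 hy
    rw [Prod.mk.injEq] at h'
    rw [← h'.2]; exact this
  · rintro rfl
    exact ⟨(a, 0), ⟨Submodule.mem_top, Submodule.zero_mem _⟩, rfl⟩

theorem finrank_Ek (k l : ℕ) : Module.finrank F (Ek F k l) = k := by
  have h : Ek F k l = LinearMap.range ((sg F k l : ((Fin k → F) × (Fin l → F)) →ₗ[F] (Fin (k + l) → F))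
      ∘ₗ LinearMap.inl F _ _) := by
    ext v
    obtain ⟨⟨a, b⟩, rfl⟩ := (sg F k l).surjective v
    rw [mem_Ek]
    constructor
    · rintro rfl
      exact ⟨a, rfl⟩
    · rintro ⟨a', ha⟩
      have h' : (a', 0) = (a, b) := (sg F k l).injective ha
      rw [Prod.mk.injEq] at h'
      exact h'.2.symm
  rw [h]
  refine (LinearMap.finrank_range_of_inj (f := (sg F k l : ((Fin k → F) × (Fin l → F)) →ₗ[F]
    (Fin (k + l) → F)) ∘ₗ LinearMap.inl F _ _)
    ((sg F k l).injective.comp LinearMap.inl_injective)).trans ?_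
  exact Module.finrank_fin_fun F

theorem isBUT_iff (k l : ℕ) (m : gl F (k + l)) :
    IsBUT k l m ↔ ∀ v ∈ Ek F k l, m *ᵥ v ∈ Ek F k l := by
  constructor
  · intro h v hv
    obtain ⟨⟨a, b⟩, rfl⟩ := (sg F k l).surjective v
    rw [mem_Ek] at hv
    subst hv
    rw [act, mem_Ek, h]
    simp
  · intro h
    unfold IsBUT
    apply Matrix.toLin'.injective
    refine LinearMap.ext fun a => ?_
    have := h _ ((mem_Ek k l a 0).2 rfl)
    rw [act, mem_Ek] at this
    simpa using this

theorem H_proj {h : Obj F → Obj F → ℂ} (ha : ∀ A A' B, Iso A A' → h A B = h A' B)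
    (hb : ∀ A B B', Iso B B' → h A B = h A B') (k l : ℕ) (m : gl F (k + l)) :
    (if IsBUT k l m then h (O (proj k l m).1) (O (proj k l m).2) else 0) =
    H h (O m) (Ek F k l) := by
  split_ifs with hm
  · rw [← H_ext ha hb (O (proj k l m).1) (O (proj k l m).2) (Matrix.toLin' (toBlocks₁₂ (blk k l m)))]
    exact H_iso ha hb (M := ext (O (proj k l m).1) (O (proj k l m).2)
      (Matrix.toLin' (toBlocks₁₂ (blk k l m)))) (M' := O m) (sg F k l) (iso_tri k l m hm) _
  · rw [isBUT_iff] at hm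
    exact Eq.symm (show H h (O m) (Ek F k l) = 0 from dif_neg hm)

theorem H_conj {h : Obj F → Obj F → ℂ} (ha : ∀ A A' B, Iso A A' → h A B = h A' B)
    (hb : ∀ A B B', Iso B B' → h A B = h A B') (k l : ℕ) (g : GL (Fin (k + l)) F)
    (z : gl F (k + l)) :
    H h (O (conjM g z)) (Ek F k l) = H h (O z) ((Ek F k l).comap (ge g : (Fin (k + l) → F) →ₗ[F] (Fin (k + l) → F))) := by
  refine Eq.trans ?_ (H_iso ha hb (M := O z) (M' := O (conjM g z)) (ge g) (ge_z g z) _).symm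
  exact congrArg (H h (O (conjM g z)))
    (Submodule.map_comap_eq_of_surjective (ge g).surjective _).symm

theorem exists_g (k l : ℕ) (N : Submodule F (Fin (k + l) → F)) (hN : Module.finrank F N = k) :
    ∃ g : GL (Fin (k + l)) F, (Ek F k l).comap (ge g : (Fin (k + l) → F) →ₗ[F] (Fin (k + l) → F)) = N := by
  obtain ⟨C, hC⟩ := Submodule.exists_isCompl N
  have hfC : Module.finrank F C = l := by
    have := Submodule.finrank_add_eq_of_isCompl hC
    rw [Module.finrank_fin_fun] at this
    omega
  let e1 : (Fin k → F) ≃ₗ[F] N := LinearEquiv.ofFinrankEq _ _ (by rw [hN, Module.finrank_fin_fun])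
  let e2 : (Fin l → F) ≃ₗ[F] C := LinearEquiv.ofFinrankEq _ _ (by rw [hfC, Module.finrank_fin_fun])
  let e : ((Fin k → F) × (Fin l → F)) ≃ₗ[F] (Fin (k + l) → F) :=
    (e1.prodCongr e2).trans (Submodule.prodEquivOfIsCompl N C hC)
  have he : ∀ x y, e (x, y) = (e1 x : Fin (k + l) → F) + (e2 y : Fin (k + l) → F) := fun x y => rfl
  obtain ⟨g, hg⟩ := exists_ge (e.symm.trans (sg F k l))
  refine ⟨g, ?_⟩
  ext v
  obtain ⟨⟨a, b⟩, rfl⟩ := e.surjective v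
  have h1 : ge g (e (a, b)) = sg F k l (a, b) := by
    rw [hg]
    change sg F k l (e.symm (e (a, b))) = _
    rw [e.symm_apply_apply]
  change ge g (e (a, b)) ∈ Ek F k l ↔ _
  rw [h1, mem_Ek, he]
  constructor
  · rintro rfl
    simp
  · intro h
    have h2 : (e2 b : Fin (k + l) → F) ∈ N := by
      have := N.sub_mem h (e1 a).2
      simpa using this
    have h3 : (e2 b : Fin (k + l) → F) = 0 := by
      have := hC.disjoint.le_bot ⟨h2, (e2 b).2⟩
      simpa using this
    have h4 : e2 b = 0 := Subtype.ext h3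
    simpa using h4

theorem comap_eq_iff (k l : ℕ) (p : GL (Fin (k + l)) F) :
    (Ek F k l).comap (ge p : (Fin (k + l) → F) →ₗ[F] (Fin (k + l) → F)) = Ek F k l ↔
      IsBUT k l (p : Matrix (Fin (k + l)) (Fin (k + l)) F) := by
  rw [isBUT_iff]
  constructor
  · intro h v hv
    rw [← h] at hv
    exact hv
  · intro h
    symm
    apply Submodule.eq_of_le_of_finrank_eq
    · intro v hv
      exact h v hv
    · rw [← LinearEquiv.finrank_map_eq (ge p) ((Ek F k l).comap (ge p : (Fin (k + l) → F) →ₗ[F] (Fin (k + l) → F)))]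
      have : Submodule.map (ge p : (Fin (k + l) → F) →ₗ[F] _)
        ((Ek F k l).comap (ge p : (Fin (k + l) → F) →ₗ[F] _)) = Ek F k l :=
        Submodule.map_comap_eq_of_surjective (ge p).surjective _
      rw [this]

theorem ge_mul {n : ℕ} (g g' : GL (Fin n) F) (v : Fin n → F) : ge (g * g') v = ge g (ge g' v) := by
  rw [ge_apply, ge_apply, ge_apply, Matrix.mulVec_mulVec]
  rfl

theorem card_fiber (k l : ℕ) (N : Submodule F (Fin (k + l) → F)) (hN : Module.finrank F N = k) :
    (Finset.univ.filter fun g : GL (Fin (k + l)) F =>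
      (Ek F k l).comap (ge g : (Fin (k + l) → F) →ₗ[F] (Fin (k + l) → F)) = N).card = Pcard F k l := by
  obtain ⟨g0, hg0⟩ := exists_g k l N hN
  unfold Pcard
  rw [Nat.card_eq_fintype_card, ← Fintype.card_subtype]
  symm
  refine Fintype.card_congr ((Equiv.mulRight g0).subtypeEquiv fun p => ?_)
  rw [← comap_eq_iff, ← hg0]
  change _ ↔ (Ek F k l).comap (ge (p * g0) : (Fin (k + l) → F) →ₗ[F] (Fin (k + l) → F)) = _
  have : (Ek F k l).comap (ge (p * g0) : (Fin (k + l) → F) →ₗ[F] _) =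
      ((Ek F k l).comap (ge p : (Fin (k + l) → F) →ₗ[F] _)).comap (ge g0 : _ →ₗ[F] _) := by
    ext v
    change ge (p * g0) v ∈ Ek F k l ↔ ge p (ge g0 v) ∈ Ek F k l
    rw [ge_mul]
  rw [this]
  exact (Submodule.comap_injective_of_surjective (ge g0).surjective).eq_iff.symm

theorem Pcard_ne (k l : ℕ) : Pcard F k l ≠ 0 := by
  unfold Pcard
  have : Nonempty {g : GL (Fin (k + l)) F // IsBUT k l (g : Matrix (Fin (k + l)) (Fin (k + l)) F)} := by
    refine ⟨⟨1, ?_⟩⟩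
    rw [isBUT_iff]
    intro v hv
    simpa using hv
  exact Nat.card_pos.ne'

theorem HCind_eq {h : Obj F → Obj F → ℂ} (ha : ∀ A A' B, Iso A A' → h A B = h A' B)
    (hb : ∀ A B B', Iso B B' → h A B = h A B') (k l : ℕ) (z : gl F (k + l)) :
    HCind k l (fun p => h (O p.1) (O p.2)) z =
    ∑ N : (O z).St, if ((O z).sub N).dim = k then h ((O z).sub N) ((O z).quo N) else 0 := by
  unfold HCind
  split_ifs with hk hl
  · rw [Finset.sum_eq_single (O z).bot]
    · rw [if_pos (by rw [dim_sub_bot, hk])]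
      change h (O 0) (O (castM _ z)) = _
      rw [O_cast, hb _ _ _ (quo_bot (O z))]
      exact ha _ _ _ (iso_of_dim_zero (by rw [dim_O, hk]) (dim_sub_bot _))
    · intro N _ hN
      exact if_neg fun h0 => hN (eq_bot_of_dim (h0.trans hk))
    · simp
  · rw [Finset.sum_eq_single (O z).top]
    · rw [if_pos (by rw [dim_sub_top, dim_O, hl, add_zero])]
      change h (O (castM _ z)) (O 0) = _
      rw [O_cast, ha _ _ _ (sub_top (O z))]
      exact hb _ _ _ (iso_of_dim_zero (by rw [dim_O, hl]) (dim_quo_top _))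
    · intro N _ hN
      refine if_neg fun h0 => hN (eq_top_of_dim ?_)
      have := dim_sub_add_quo (O z) N
      rw [dim_O] at this
      omega
    · simp
  · have h1 : ∀ g : GL (Fin (k + l)) F, (if IsBUT k l (conjM g z) then
        h (O (proj k l (conjM g z)).1) (O (proj k l (conjM g z)).2) else 0) =
        ∑ N : Submodule F (Fin (k + l) → F),
          if (Ek F k l).comap (ge g : (Fin (k + l) → F) →ₗ[F] (Fin (k + l) → F)) = N then H h (O z) N else 0 := by
      intro g
      rw [H_proj ha hb, H_conj ha hb]
      refine Eq.symm ((Finset.sum_ite_eq Finset.univ _ (fun N : Submodule F (Fin (k + l) → F) =>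
        H h (O z) N)).trans ?_)
      exact if_pos (Finset.mem_univ _)
    change (Pcard F k l : ℂ)⁻¹ * (∑ g : GL (Fin (k + l)) F, (if IsBUT k l (conjM g z) then
        h (O (proj k l (conjM g z)).1) (O (proj k l (conjM g z)).2) else 0)) = _
    rw [Finset.sum_congr rfl fun g _ => h1 g, Finset.sum_comm, Finset.mul_sum]
    have h2 : ∀ N : Submodule F (Fin (k + l) → F), (Pcard F k l : ℂ)⁻¹ *
        (∑ g : GL (Fin (k + l)) F,
          if (Ek F k l).comap (ge g : (Fin (k + l) → F) →ₗ[F] (Fin (k + l) → F)) = N then H h (O z) N else 0) =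
        if Module.finrank F N = k then H h (O z) N else 0 := by
      intro N
      rw [← Finset.sum_filter, Finset.sum_const, nsmul_eq_mul]
      split_ifs with hN
      · rw [card_fiber k l N hN, inv_mul_cancel_left₀]
        exact_mod_cast Pcard_ne k l
      · rw [Finset.filter_false_of_mem]
        · simp
        · rintro g - rfl
          apply hN
          rw [← LinearEquiv.finrank_map_eq (ge g)]
          have : Submodule.map (ge g : (Fin (k + l) → F) →ₗ[F] _)
            ((Ek F k l).comap (ge g : (Fin (k + l) → F) →ₗ[F] _)) = Ek F k l :=
            Submodule.map_comap_eq_of_surjective (ge g).surjective _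
          rw [this, finrank_Ek]
    rw [Finset.sum_congr rfl fun N _ => h2 N]
    symm
    refine (sum_subtype_dite (fun N : Submodule F (O z).V => ∀ v ∈ N, (O z).z v ∈ N)
      (fun N => if ((O z).sub N).dim = k then h ((O z).sub N) ((O z).quo N) else 0)).trans ?_
    refine Finset.sum_congr rfl fun N _ => ?_
    unfold H
    by_cases hs : ∀ v ∈ N, (O z).z v ∈ N
    · rw [dif_pos hs, dif_pos hs]
      rfl
    · rw [dif_neg hs, dif_neg hs]
      simp

theorem RcompRes_eq (L : List ℕ) : ∀ g : Obj F → ℂ, Inv g →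
    RcompRes L (fun x => g (O x)) = fun x => RL L g (O x) := by
  induction L with
  | nil => intro g _; rfl
  | cons k L ih =>
    intro g hg
    rw [RcompRes]
    rw [castFun_O]
    have h1 : (fun p : gl F k × gl F L.sum => RcompRes L (fun y => HCres k L.sum
        (fun x => g (O x)) (p.1, y)) p.2) = fun p => RL L (delta g (O p.1)) (O p.2) := by
      funext p
      have : (fun y => HCres k L.sum (fun x => g (O x)) (p.1, y)) = fun y => delta g (O p.1) (O y) :=
        funext fun y => HCres_eq hg k L.sum p.1 y
      rw [this, ih _ (delta_inv hg _)]
    rw [h1]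
    have h2 : HCind k L.sum (fun p => RL L (delta g (O p.1)) (O p.2)) =
        fun z => RL (k :: L) g (O z) := by
      funext z
      exact HCind_eq (h := fun A B => RL L (delta g A) B)
        (fun A A' B hA => by simp only [delta_congr_left hg hA])
        (fun A B B' hB => RL_inv L _ (delta_inv hg A) _ _ hB) k L.sum z
    rw [h2, castFun_O]

theorem Dual_eq {n : ℕ} {g : Obj F → ℂ} (hg : Inv g) :
    Dual n (fun x => g (O x)) = fun x => (((-1 : ℂ) ^ n) • S g) (O x) := by
  funext x
  rw [Pi.smul_apply, ← T_eq n g (O x) (dim_O x)]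
  unfold Dual
  rw [Finset.sum_apply, Finset.smul_sum]
  refine Finset.sum_congr rfl fun c _ => ?_
  rw [Pi.smul_apply, castFun_O, RcompRes_eq _ _ hg, castFun_O, smul_eq_mul, smul_eq_mul, ← mul_assoc]
  congr 1
  have hl : c.length ≤ n := c.length_le
  obtain ⟨d, hd⟩ := Nat.exists_eq_add_of_le hl
  change _ = (-1 : ℂ) ^ n * (-1) ^ c.length
  have h1 : n - c.length = d := by omega
  have h2 : (-1 : ℂ) ^ n = (-1) ^ c.length * (-1) ^ d := by rw [← pow_add, ← hd]
  rw [h1, h2, mul_right_comm, ← mul_pow]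
  simp

theorem dual_dual {n : ℕ} {f : gl F n → ℂ} (hf : Invariant n f) : Dual n (Dual n f) = f := by
  have h1 : f = fun x => hat f (O x) := funext fun x => (hat_O hf x).symm
  have hi : Inv (((-1 : ℂ) ^ n) • S (hat f)) := fun A B h => by
    rw [Pi.smul_apply, Pi.smul_apply, S_inv (hat_inv hf) _ _ h]
  have h2 : Dual n f = fun x => (((-1 : ℂ) ^ n) • S (hat f)) (O x) := by
    conv_lhs => rw [h1]
    exact Dual_eq (hat_inv hf)
  rw [h2, Dual_eq hi, S_smul, SS_eq (hat_inv hf), smul_smul, ← mul_pow]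
  simp only [mul_neg, mul_one, neg_neg, one_pow, one_smul]
  exact h1.symm

end Obj
end HCAux

namespace HCPaper

open scoped Classical

/-- the duality operation is involutive. -/
theorem dual_involutive (F : Type) [Field F] [Fintype F] [DecidableEq F]
    (n : ℕ) (f : gl F n → ℂ) (hf : Invariant n f) :
    Dual n (Dual n f) = f := by
  exact HCAux.Obj.dual_dual hf

end HCPaper
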